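/- arXiv:math/0002128 — 3 statements merged into one kernel-verified Lean document; each statement's English description precedes it below -/
import Mathlib

section
/- Let (A,R) be a pseudoinvolutive cotriangular Hopf algebra over k with Drinfeld element u. Then there exists an algebra homomorphism c : A → k (a grouplike element of A*) which is central in the convolution algebra A* and satisfies c∗c = ε, such that for every finite-dimensional right A-comodule V with decomposition V = V₊ ⊕ V₋ into positive and negative parts, the endomorphism c|_V equals the identity on V₊ and minus the identity on V₋. -/
open TensorProduct LinearMap

noncomputable section

universe u
variable {k A : Type u} [Field k] [Ring A] [HopfAlgebra k A]

/-- The convolution product on `Hom_k(A, k)`:  `(f ∗ g)(a) = Σ f(a₁) g(a₂)`. -/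
def conv1 (f g : A →ₗ[k] k) : A →ₗ[k] k :=
  mul' k k ∘ₗ map f g ∘ₗ Coalgebra.comul

/-- The convolution product on `Hom_k(A ⊗ A, k)` (using the tensor-product coalgebra
structure of `A ⊗ A`):  `(f ∗ g)(a ⊗ b) = Σ f(a₁ ⊗ b₁) g(a₂ ⊗ b₂)`. -/
def conv2 (f g : A ⊗[k] A →ₗ[k] k) : A ⊗[k] A →ₗ[k] k :=
  mul' k k ∘ₗ map f g ∘ₗ (Coalgebra.comul : A ⊗[k] A →ₗ[k] (A ⊗[k] A) ⊗[k] (A ⊗[k] A))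

/-- The counit of the coalgebra `A ⊗ A`, i.e. `a ⊗ b ↦ ε(a) ε(b)`; this is the unit of the
convolution algebra `(A ⊗ A)*`. -/
def eps2 : A ⊗[k] A →ₗ[k] k := (Coalgebra.counit : A ⊗[k] A →ₗ[k] k)

/-- Coquasitriangularity of a linear form `R : A ⊗ A → k` with respect to a (possibly
twisted) multiplication `m` on the underlying coalgebra of `A` (with the same unit `1`):
`R` is convolution invertible and
`R(m(a⊗b) ⊗ c) = Σ R(a⊗c₁) R(b⊗c₂)`, `R(a ⊗ m(b⊗c)) = Σ R(a₁⊗c) R(a₂⊗b)`,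
`R(a⊗1) = ε(a) = R(1⊗a)`, and `Σ m(b₁⊗a₁) R(a₂⊗b₂) = Σ R(a₁⊗b₁) m(a₂⊗b₂)`. -/
structure IsCQT (m : A ⊗[k] A →ₗ[k] A) (R : A ⊗[k] A →ₗ[k] k) : Prop where
  conv_invertible : ∃ Rinv, conv2 R Rinv = eps2 ∧ conv2 Rinv R = eps2
  mul_left : R ∘ₗ map m LinearMap.id =
    mul' k k ∘ₗ map R R ∘ₗ (tensorTensorTensorComm k A A A A).toLinearMap ∘ₗ
      map LinearMap.id Coalgebra.comul
  mul_right : R ∘ₗ map LinearMap.id m =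
    mul' k k ∘ₗ map R R ∘ₗ (tensorTensorTensorComm k A A A A).toLinearMap ∘ₗ
      map LinearMap.id (TensorProduct.comm k A A).toLinearMap ∘ₗ
      map Coalgebra.comul LinearMap.id
  unit_right : ∀ a : A, R (a ⊗ₜ 1) = Coalgebra.counit a
  unit_left : ∀ a : A, R (1 ⊗ₜ a) = Coalgebra.counit a
  comm_rel : (TensorProduct.rid k A).toLinearMap ∘ₗ
      map (m ∘ₗ (TensorProduct.comm k A A).toLinearMap) R ∘ₗ
      (Coalgebra.comul : A ⊗[k] A →ₗ[k] (A ⊗[k] A) ⊗[k] (A ⊗[k] A)) =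
    (TensorProduct.lid k A).toLinearMap ∘ₗ map R m ∘ₗ
      (Coalgebra.comul : A ⊗[k] A →ₗ[k] (A ⊗[k] A) ⊗[k] (A ⊗[k] A))

/-- Cotriangularity: coquasitriangular, and the convolution inverse of `R` is `R ∘ τ`. -/
structure IsCT (m : A ⊗[k] A →ₗ[k] A) (R : A ⊗[k] A →ₗ[k] k) extends IsCQT m R : Prop where
  tri_right : conv2 R (R ∘ₗ (TensorProduct.comm k A A).toLinearMap) = eps2
  tri_left : conv2 (R ∘ₗ (TensorProduct.comm k A A).toLinearMap) R = eps2

/-- The Drinfeld element `u ∈ A*`, `u(a) = Σ R(a₂ ⊗ S(a₁))`. -/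
def drinfeld (R : A ⊗[k] A →ₗ[k] k) : A →ₗ[k] k :=
  R ∘ₗ map LinearMap.id (HopfAlgebra.antipode (R := k)) ∘ₗ
    (TensorProduct.comm k A A).toLinearMap ∘ₗ Coalgebra.comul

/-- `ρ` makes `V` into a right `A`-comodule:  `(ρ ⊗ id) ∘ ρ = (id ⊗ Δ) ∘ ρ` and
`(id ⊗ ε) ∘ ρ = id`. -/
structure IsComod (V : Type u) [AddCommGroup V] [Module k V]
    (ρ : V →ₗ[k] V ⊗[k] A) : Prop where
  coassoc : (TensorProduct.assoc k V A A).toLinearMap ∘ₗ map ρ LinearMap.id ∘ₗ ρ =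
    map LinearMap.id Coalgebra.comul ∘ₗ ρ
  counit_id : (TensorProduct.rid k V).toLinearMap ∘ₗ map LinearMap.id Coalgebra.counit ∘ₗ ρ =
    LinearMap.id

/-- The endomorphism `f|_V : v ↦ (id ⊗ f)(ρ(v))` of a right `A`-comodule `(V, ρ)` attached to a
linear form `f ∈ A*`. -/
def coact {V : Type u} [AddCommGroup V] [Module k V] (ρ : V →ₗ[k] V ⊗[k] A)
    (f : A →ₗ[k] k) : V →ₗ[k] V :=
  (TensorProduct.rid k V).toLinearMap ∘ₗ map LinearMap.id f ∘ₗ ρ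

/-- Pseudoinvolutivity: `tr(S²|_C) = dim C` for every finite-dimensional subcoalgebra `C ⊆ A`. -/
def Pseudoinvolutive (k A : Type u) [Field k] [Ring A] [HopfAlgebra k A] : Prop :=
  ∀ C : Submodule k A, FiniteDimensional k C →
    (∀ c ∈ C, Coalgebra.comul c ∈ LinearMap.range (map C.subtype C.subtype)) →
    ∀ h : ∀ x ∈ C, (HopfAlgebra.antipode (R := k) ∘ₗ HopfAlgebra.antipode (R := k)) x ∈ C,
      trace k C ((HopfAlgebra.antipode (R := k) ∘ₗ HopfAlgebra.antipode (R := k)).restrict h) =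
        (Module.finrank k C : k)

/-- `c ∈ A*` is a grouplike element of the dual, i.e. an algebra homomorphism `A → k`. -/
def IsGrouplikeForm (c : A →ₗ[k] k) : Prop :=
  c 1 = 1 ∧ ∀ a b : A, c (a * b) = c a * c b

/-- `c` is central in the convolution algebra `A*`. -/
def IsConvCentral (c : A →ₗ[k] k) : Prop :=
  ∀ f : A →ₗ[k] k, conv1 c f = conv1 f c

/-- The linear form `a ⊗ b ↦ f(a) g(b)` on `A ⊗ A`. -/
def pairForm (f g : A →ₗ[k] k) : A ⊗[k] A →ₗ[k] k := mul' k k ∘ₗ map f g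

/-- The cotriangular structure
`R_c = ½ (ε⊗ε + ε⊗c + c⊗ε − c⊗c)` attached to a central grouplike `c ∈ A*` of order `≤ 2`. -/
def Rc (c : A →ₗ[k] k) : A ⊗[k] A →ₗ[k] k :=
  (2⁻¹ : k) • (pairForm Coalgebra.counit Coalgebra.counit + pairForm Coalgebra.counit c +
    pairForm c Coalgebra.counit - pairForm c c)

/-- A submodule `W ≤ V` is a subcomodule of the comodule `(V, ρ)`. -/
def IsSubcomod {V : Type u} [AddCommGroup V] [Module k V] (ρ : V →ₗ[k] V ⊗[k] A)
    (W : Submodule k V) : Prop :=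
  ∀ w ∈ W, ρ w ∈ LinearMap.range (map W.subtype (LinearMap.id : A →ₗ[k] A))

/-- A linear map between comodules is a comodule morphism. -/
def IsComodMap {V W : Type u} [AddCommGroup V] [Module k V] [AddCommGroup W] [Module k W]
    (ρV : V →ₗ[k] V ⊗[k] A) (ρW : W →ₗ[k] W ⊗[k] A) (f : V →ₗ[k] W) : Prop :=
  ρW ∘ₗ f = map f LinearMap.id ∘ₗ ρV


/-- A subcomodule `W` of `(V, ρ)` is positive: `tr(u|_W) = dim W`. -/
def SubPos {V : Type u} [AddCommGroup V] [Module k V] (ρ : V →ₗ[k] V ⊗[k] A)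
    (u : A →ₗ[k] k) (W : Submodule k V) : Prop :=
  ∃ h : ∀ x ∈ W, coact ρ u x ∈ W,
    trace k W ((coact ρ u).restrict h) = (Module.finrank k W : k)

/-- A subcomodule `W` of `(V, ρ)` is negative: `tr(u|_W) = -dim W`. -/
def SubNeg {V : Type u} [AddCommGroup V] [Module k V] (ρ : V →ₗ[k] V ⊗[k] A)
    (u : A →ₗ[k] k) (W : Submodule k V) : Prop :=
  ∃ h : ∀ x ∈ W, coact ρ u x ∈ W,
    trace k W ((coact ρ u).restrict h) = -(Module.finrank k W : k)

section

theorem Matrix.exists_eq_smul_trace_of_mul_comm {k ι : Type*} [Field k] [Fintype ι] [DecidableEq ι]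
    (ψ : Matrix ι ι k →ₗ[k] k) (hψ : ∀ x y, ψ (x * y) = ψ (y * x)) :
    ∃ a : k, ∀ x, ψ x = a * x.trace := by
  rcases isEmpty_or_nonempty ι with h | ⟨⟨o⟩⟩
  · exact ⟨0, fun x => by rw [Subsingleton.elim x 0]; simp⟩
  refine ⟨ψ (Matrix.single o o 1), fun x => ?_⟩
  have key : ∀ i j, ψ (Matrix.single i j 1) = if i = j then ψ (Matrix.single o o 1) else 0 := by
    intro i j
    have := hψ (Matrix.single i o 1) (Matrix.single o j 1)
    rw [Matrix.single_mul_single_same] at this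
    split_ifs with h
    · subst h
      rw [Matrix.single_mul_single_same] at this
      simpa using this
    · rw [Matrix.single_mul_single_of_ne _ _ _ _ (Ne.symm h)] at this
      simpa using this
  conv_lhs => rw [Matrix.matrix_eq_sum_single x]
  simp only [map_sum]
  have : ∀ i j, ψ (Matrix.single i j (x i j)) =
      if i = j then x i j * ψ (Matrix.single o o 1) else 0 := by
    intro i j
    have h : Matrix.single i j (x i j) = x i j • Matrix.single i j (1 : k) := by simp
    rw [h, map_smul, key]
    simp
  simp only [this, Finset.sum_ite_eq, Finset.mem_univ, if_true]
  rw [Matrix.trace, Finset.mul_sum]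
  exact Finset.sum_congr rfl fun i _ => by rw [Matrix.diag_apply, mul_comm]

theorem exists_semisimple_quotient {k B : Type*} [Field k] [IsAlgClosed k] [Ring B] [Algebra k B]
    [FiniteDimensional k B] :
    ∃ (n : ℕ) (d : Fin n → ℕ) (q : B →ₐ[k] Π i, Matrix (Fin (d i)) (Fin (d i)) k),
      (∀ i, NeZero (d i)) ∧ Function.Surjective q ∧ ∀ x, q x = 0 → IsNilpotent x := by
  have := IsArtinianRing.of_finite k B
  obtain ⟨n, d, hd, ⟨e⟩⟩ :=
    IsSemisimpleRing.exists_algEquiv_pi_matrix_of_isAlgClosed k (B ⧸ Ring.jacobson B)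
  refine ⟨n, d, e.toAlgHom.comp (Ideal.Quotient.mkₐ k (Ring.jacobson B)), hd,
    e.surjective.comp (Ideal.Quotient.mkₐ_surjective k _), fun x hx => ?_⟩
  have hx' : x ∈ Ring.jacobson B := by
    have : e (Ideal.Quotient.mk _ x) = 0 := hx
    rw [map_eq_zero_iff e e.injective] at this
    exact Ideal.Quotient.eq_zero_iff_mem.mp this
  obtain ⟨m, hm⟩ := IsSemiprimaryRing.isNilpotent (R := B)
  exact ⟨m, by
    have := Ideal.pow_mem_pow hx' m
    rwa [hm] at this⟩

/-- If all irreducible representations send `g` and `g'` to matrices of trace `± d` and the two-sided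
multiplication by `g` and `g'` has trace `dim B`, then a central involution has the same image as
`g` under every trace function vanishing on nilpotent elements. -/
theorem exists_central_involution {k B : Type*} [Field k] [IsAlgClosed k] [CharZero k]
    [Ring B] [Algebra k B] [FiniteDimensional k B] (g g' : B)
    (h1 : ∀ (d : ℕ) (π : B →ₐ[k] Matrix (Fin d) (Fin d) k), Function.Surjective π →
      (π g).trace = (π g').trace ∧ (π g).trace * (π g').trace = (d : k) * d)
    (h2 : trace k B (mulLeft k g * mulRight k g') = (Module.finrank k B : k)) :
    ∃ c : B, c * c = 1 ∧ (∀ x, c * x = x * c) ∧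
      ∀ φ : B →ₗ[k] k, (∀ x y, φ (x * y) = φ (y * x)) → (∀ x, IsNilpotent x → φ x = 0) →
        φ g = φ c := by
  obtain ⟨n, d, q, hd, hq, hnil⟩ := exists_semisimple_quotient (k := k) (B := B)
  have hπ : ∀ i, Function.Surjective
      ((Pi.evalAlgHom k (fun i => Matrix (Fin (d i)) (Fin (d i)) k) i).comp q) :=
    fun i => (Function.surjective_eval i).comp hq
  have hsign : ∀ i, ∃ s : k, (s = 1 ∨ s = -1) ∧
      (q g i).trace = s * d i ∧ (q g' i).trace = s * d i := by
    intro i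
    obtain ⟨h, h'⟩ := h1 _ _ (hπ i)
    change (q g i).trace = (q g' i).trace at h
    change (q g i).trace * (q g' i).trace = _ at h'
    rw [← h] at h' ⊢
    rcases mul_self_eq_mul_self_iff.mp h' with h' | h'
    · exact ⟨1, Or.inl rfl, by simpa, by simpa⟩
    · exact ⟨-1, Or.inr rfl, by simpa, by simpa⟩
  choose s hs hg hg' using hsign
  let E : Π i, Matrix (Fin (d i)) (Fin (d i)) k := fun i => ((1 + s i) / 2) • 1
  have hE : IsIdempotentElem E := by
    ext1 i
    rcases hs i with h | h <;> simp [E, h]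
  obtain ⟨e, he, hqe⟩ := exists_isIdempotentElem_eq_of_ker_isNilpotent (q : B →+* _)
    (fun x hx => hnil x (RingHom.mem_ker.mp hx)) E (by obtain ⟨x, hx⟩ := hq E; exact ⟨x, hx⟩) hE
  replace hqe : q e = E := hqe
  have tf : ∀ φ : B →ₗ[k] k, (∀ x y, φ (x * y) = φ (y * x)) → (∀ x, IsNilpotent x → φ x = 0) →
      ∀ x y, (∀ i, (q x i).trace = (q y i).trace) → φ x = φ y := by
    intro φ hφ hφn x y hxy
    obtain ⟨ψ, hψ⟩ : ∃ ψ : (Π i, Matrix (Fin (d i)) (Fin (d i)) k) →ₗ[k] k,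
        ψ ∘ₗ q.toLinearMap = φ := by
      obtain ⟨r, hr⟩ := q.toLinearMap.exists_rightInverse_of_surjective
        (LinearMap.range_eq_top.mpr hq)
      refine ⟨φ ∘ₗ r, LinearMap.ext fun z => ?_⟩
      have : φ (r (q z) - z) = 0 := hφn _ (hnil _ (by
        have := LinearMap.congr_fun hr (q z)
        simp only [LinearMap.comp_apply, AlgHom.toLinearMap_apply, LinearMap.id_apply] at this
        rw [map_sub, this, sub_self]))
      rw [map_sub, sub_eq_zero] at this
      simpa using this
    have hψq : ∀ z, ψ (q z) = φ z := fun z => LinearMap.congr_fun hψ z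
    have hψc : ∀ a b, ψ (a * b) = ψ (b * a) := by
      intro a b
      obtain ⟨a, rfl⟩ := hq a
      obtain ⟨b, rfl⟩ := hq b
      rw [← map_mul, ← map_mul, hψq, hψq, hφ]
    have hc : ∀ i, ψ (Pi.single i (q x i)) = ψ (Pi.single i (q y i)) := by
      intro i
      obtain ⟨a, ha⟩ := Matrix.exists_eq_smul_trace_of_mul_comm
        (ψ ∘ₗ LinearMap.single k (fun i => Matrix (Fin (d i)) (Fin (d i)) k) i) (by
          intro a b
          simp only [LinearMap.comp_apply, LinearMap.single_apply, Pi.single_mul, hψc])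
      have h₁ := ha (q x i)
      have h₂ := ha (q y i)
      simp only [LinearMap.comp_apply, LinearMap.single_apply] at h₁ h₂
      rw [h₁, h₂, hxy]
    rw [← hψq, ← hψq, ← Finset.univ_sum_single (q x), ← Finset.univ_sum_single (q y),
      map_sum, map_sum]
    exact Finset.sum_congr rfl fun i _ => hc i
  have htr : ∀ i, (q (e - (1 - e)) i).trace = s i * d i := by
    intro i
    simp only [map_sub, hqe, map_one, Pi.sub_apply, Pi.one_apply, E, Matrix.trace_sub,
      Matrix.trace_smul, Matrix.trace_one, Fintype.card_fin, smul_eq_mul]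
    ring
  have nilL : ∀ x y : B, IsNilpotent x → IsNilpotent (mulLeft k x * mulRight k y) := fun x y hx =>
    (LinearMap.commute_mulLeft_right x y).isNilpotent_mul_right
      ((isNilpotent_mulLeft_iff k x).mpr hx)
  have nilR : ∀ x y : B, IsNilpotent y → IsNilpotent (mulLeft k x * mulRight k y) := fun x y hy =>
    (LinearMap.commute_mulLeft_right x y).isNilpotent_mul_left
      ((isNilpotent_mulRight_iff k y).mpr hy)
  have T1 : ∀ y, trace k B (mulLeft k g * mulRight k y) =
      trace k B (mulLeft k (e - (1 - e)) * mulRight k y) := by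
    intro y
    refine tf (trace k B ∘ₗ (LinearMap.mulRight k (mulRight k y)) ∘ₗ LinearMap.mul k B)
      (fun a b => ?_)
      (fun a ha => (LinearMap.isNilpotent_trace_of_isNilpotent (nilL a y ha)).eq_zero)
      _ _ (fun i => by rw [htr, hg])
    change trace k B (mulLeft k (a * b) * mulRight k y) =
      trace k B (mulLeft k (b * a) * mulRight k y)
    rw [LinearMap.mulLeft_mul, LinearMap.mulLeft_mul, ← Module.End.mul_eq_comp,
      ← Module.End.mul_eq_comp,
      mul_assoc, (LinearMap.commute_mulLeft_right b y).eq, ← mul_assoc,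
      LinearMap.trace_mul_comm, mul_assoc]
  have T2 : ∀ x, trace k B (mulLeft k x * mulRight k g') =
      trace k B (mulLeft k x * mulRight k (e - (1 - e))) := by
    intro x
    refine tf (trace k B ∘ₗ (LinearMap.mulLeft k (mulLeft k x)) ∘ₗ (LinearMap.mul k B).flip)
      (fun a b => ?_)
      (fun a ha => (LinearMap.isNilpotent_trace_of_isNilpotent (nilR x a ha)).eq_zero)
      _ _ (fun i => by rw [htr, hg'])
    change trace k B (mulLeft k x * mulRight k (a * b)) =
      trace k B (mulLeft k x * mulRight k (b * a))
    rw [LinearMap.mulRight_mul, LinearMap.mulRight_mul, ← Module.End.mul_eq_comp,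
      ← Module.End.mul_eq_comp,
      ← mul_assoc, (LinearMap.commute_mulLeft_right x b).eq, mul_assoc,
      LinearMap.trace_mul_comm, mul_assoc]
  rw [T1, T2] at h2
  set f := 1 - e with hf
  have hee : e * e = e := he
  have hef : e * f = 0 := by rw [hf, mul_sub, hee, mul_one, sub_self]
  have hfe : f * e = 0 := by rw [hf, sub_mul, hee, one_mul, sub_self]
  have hff : f * f = f := by rw [hf, mul_sub, mul_one, ← hf, hfe, sub_zero]
  have he1 : e + f = 1 := by rw [hf]; abel
  set P : B →ₗ[k] B := mulLeft k e * mulRight k f + mulLeft k f * mulRight k e with hP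
  have hPa : ∀ x, P x = e * x * f + f * x * e := by
    intro x; simp [hP, mul_assoc]
  have hPid : IsIdempotentElem P := by
    ext x
    have h₁ : ∀ z, e * (e * z) = e * z := fun z => by rw [← mul_assoc, hee]
    have h₂ : ∀ z, e * (f * z) = 0 := fun z => by rw [← mul_assoc, hef, zero_mul]
    have h₃ : ∀ z, f * (e * z) = 0 := fun z => by rw [← mul_assoc, hfe, zero_mul]
    have h₄ : ∀ z, f * (f * z) = f * z := fun z => by rw [← mul_assoc, hff]
    simp only [Module.End.mul_apply, hPa, mul_add, mul_assoc, h₁, h₂, h₃, h₄, hee, hff,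
      add_zero, zero_add]
  have hsum : mulLeft k (e - f) * mulRight k (e - f) = 1 - (P + P) := by
    ext x
    have : x = (e + f) * x * (e + f) := by rw [he1, one_mul, mul_one]
    simp only [Module.End.mul_apply, mulLeft_apply, mulRight_apply, LinearMap.sub_apply,
      Module.End.one_apply, LinearMap.add_apply, hPa]
    conv_rhs => enter [1]; rw [this]
    noncomm_ring
  have hP0 : P = 0 := by
    rw [hsum, map_sub, LinearMap.trace_one, map_add] at h2
    exact hPid.eq_zero_of_trace_eq_zero (by linear_combination (-1 / 2 : k) * h2)
  have hz : ∀ x, e * x * f = 0 ∧ f * x * e = 0 := by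
    intro x
    have h : e * x * f + f * x * e = 0 := by rw [← hPa, hP0]; rfl
    constructor
    · have := congrArg (e * ·) h
      simpa only [mul_add, ← mul_assoc, hee, hef, zero_mul, add_zero, mul_zero] using this
    · have := congrArg (f * ·) h
      simpa only [mul_add, ← mul_assoc, hfe, hff, zero_mul, zero_add, mul_zero] using this
  have hcen : ∀ x, e * x = x * e := by
    intro x
    have h₁ : e * x = e * x * e := by
      conv_lhs => rw [← mul_one (e * x), ← he1, mul_add, (hz x).1, add_zero]
    have h₂ : x * e = e * x * e := by
      conv_lhs => rw [← one_mul x, ← he1, add_mul, add_mul, (hz x).2, add_zero]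
    rw [h₁, ← h₂]
  refine ⟨e - f, ?_, fun x => ?_, fun φ hφ hφn => tf φ hφ hφn _ _ fun i => ?_⟩
  · simp only [mul_sub (e - f), sub_mul e f, hee, hef, hfe, hff, sub_zero, zero_sub,
      sub_neg_eq_add, he1]
  · simp only [hf, sub_mul, mul_sub, one_mul, mul_one, hcen]
  · rw [htr, hg]

open scoped Matrix
open HopfAlgebra (antipode)

/-- A square matrix `t` over `A` is multiplicative if `Δ(tᵢⱼ) = Σ tᵢₗ ⊗ tₗⱼ` and
`ε(tᵢⱼ) = δᵢⱼ`; these are the matrices of coefficients of finite-dimensional comodules. -/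
structure IsMultiplicative (k : Type u) {A : Type u} [Field k] [Ring A] [HopfAlgebra k A]
    {ι : Type*} [Fintype ι] [DecidableEq ι] (t : Matrix ι ι A) : Prop where
  comul : ∀ i j, Coalgebra.comul (R := k) (t i j) = ∑ l, t i l ⊗ₜ[k] t l j
  counit : ∀ i j, Coalgebra.counit (R := k) (t i j) = (1 : Matrix ι ι k) i j

section Evaluation

variable {m n : Type*} [Fintype m] [Fintype n]

theorem conv1_of_comul {a : A} {x y : m → A}
    (h : Coalgebra.comul (R := k) a = ∑ l, x l ⊗ₜ[k] y l) (f g : A →ₗ[k] k) :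
    conv1 f g a = ∑ l, f (x l) * g (y l) := by
  simp [conv1, h, map_sum]

theorem comul_tmul_of_comul {a b : A} {x y : m → A} {z w : n → A}
    (ha : Coalgebra.comul (R := k) a = ∑ l, x l ⊗ₜ[k] y l)
    (hb : Coalgebra.comul (R := k) b = ∑ l, z l ⊗ₜ[k] w l) :
    Coalgebra.comul (R := k) (a ⊗ₜ[k] b) =
      ∑ l, ∑ r, (x l ⊗ₜ[k] z r) ⊗ₜ[k] (y l ⊗ₜ[k] w r) := by
  rw [TensorProduct.comul_tmul, ha, hb]
  simp only [TensorProduct.sum_tmul, TensorProduct.tmul_sum, map_sum,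
    AlgebraTensorModule.tensorTensorTensorComm_tmul]
  exact Finset.sum_comm

theorem conv2_of_comul {a b : A} {x y : m → A} {z w : n → A}
    (ha : Coalgebra.comul (R := k) a = ∑ l, x l ⊗ₜ[k] y l)
    (hb : Coalgebra.comul (R := k) b = ∑ l, z l ⊗ₜ[k] w l) (f g : A ⊗[k] A →ₗ[k] k) :
    conv2 f g (a ⊗ₜ b) = ∑ l, ∑ r, f (x l ⊗ₜ z r) * g (y l ⊗ₜ w r) := by
  simp [conv2, comul_tmul_of_comul ha hb, map_sum]

variable {R : A ⊗[k] A →ₗ[k] k}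

theorem IsCQT.apply_mul_left (hR : IsCQT (mul' k A) R) (a b : A) {c : A} {x y : m → A}
    (h : Coalgebra.comul (R := k) c = ∑ l, x l ⊗ₜ[k] y l) :
    R ((a * b) ⊗ₜ c) = ∑ l, R (a ⊗ₜ x l) * R (b ⊗ₜ y l) := by
  have := LinearMap.congr_fun hR.mul_left ((a ⊗ₜ b) ⊗ₜ c)
  simpa [h, map_sum, TensorProduct.tmul_sum] using this

theorem IsCQT.apply_mul_right (hR : IsCQT (mul' k A) R) {a : A} {x y : m → A}
    (h : Coalgebra.comul (R := k) a = ∑ l, x l ⊗ₜ[k] y l) (b c : A) :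
    R (a ⊗ₜ (b * c)) = ∑ l, R (x l ⊗ₜ c) * R (y l ⊗ₜ b) := by
  have := LinearMap.congr_fun hR.mul_right (a ⊗ₜ (b ⊗ₜ c))
  simpa [h, map_sum, TensorProduct.sum_tmul] using this

theorem IsCQT.mul_comm_of_comul (hR : IsCQT (mul' k A) R) {a b : A} {x y : m → A} {z w : n → A}
    (ha : Coalgebra.comul (R := k) a = ∑ l, x l ⊗ₜ[k] y l)
    (hb : Coalgebra.comul (R := k) b = ∑ l, z l ⊗ₜ[k] w l) :
    ∑ l, ∑ r, R (y l ⊗ₜ w r) • (z r * x l) = ∑ l, ∑ r, R (x l ⊗ₜ z r) • (y l * w r) := by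
  have := LinearMap.congr_fun hR.comm_rel (a ⊗ₜ b)
  simpa only [LinearMap.comp_apply, comul_tmul_of_comul ha hb, map_sum, TensorProduct.map_tmul,
    LinearEquiv.coe_coe, TensorProduct.comm_tmul, mul'_apply, TensorProduct.rid_tmul,
    TensorProduct.lid_tmul] using this

theorem drinfeld_of_comul {a : A} {x y : m → A}
    (h : Coalgebra.comul (R := k) a = ∑ l, x l ⊗ₜ[k] y l) :
    drinfeld R a = ∑ l, R (y l ⊗ₜ antipode k (x l)) := by
  simp [drinfeld, h, map_sum]

/-- The linear form `a ↦ Σ R(a₁ ⊗ S(a₂))`, the convolution inverse of the Drinfeld element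
of a cotriangular structure. -/
def drinfeldInv (R : A ⊗[k] A →ₗ[k] k) : A →ₗ[k] k :=
  R ∘ₗ map LinearMap.id (antipode k) ∘ₗ Coalgebra.comul

theorem drinfeldInv_of_comul {a : A} {x y : m → A}
    (h : Coalgebra.comul (R := k) a = ∑ l, x l ⊗ₜ[k] y l) :
    drinfeldInv R a = ∑ l, R (x l ⊗ₜ antipode k (y l)) := by
  simp [drinfeldInv, h, map_sum]

end Evaluation

namespace IsMultiplicative

variable {ι κ : Type*} [Fintype ι] [DecidableEq ι] [Fintype κ] [DecidableEq κ]
  {t : Matrix ι ι A} {s : Matrix κ κ A}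

theorem map_conv1 (ht : IsMultiplicative k t) (f g : A →ₗ[k] k) :
    t.map (conv1 f g) = t.map f * t.map g := by
  ext i j
  simp [conv1_of_comul (ht.comul i j), Matrix.mul_apply]

theorem map_counit (ht : IsMultiplicative k t) :
    t.map (Coalgebra.counit : A →ₗ[k] k) = 1 := by
  ext i j
  simp [ht.counit]

theorem sum_mul_antipode (ht : IsMultiplicative k t) (i j : ι) :
    ∑ l, t i l * antipode k (t l j) = (1 : Matrix ι ι A) i j := by
  have := HopfAlgebra.mul_antipode_lTensor_comul_apply (R := k) (t i j)
  rw [ht.comul, ht.counit] at this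
  simpa [map_sum, Matrix.one_apply, apply_ite (algebraMap k A)] using this

theorem sum_antipode_mul (ht : IsMultiplicative k t) (i j : ι) :
    ∑ l, antipode k (t i l) * t l j = (1 : Matrix ι ι A) i j := by
  have := HopfAlgebra.mul_antipode_rTensor_comul_apply (R := k) (t i j)
  rw [ht.comul, ht.counit] at this
  simpa [map_sum, Matrix.one_apply, apply_ite (algebraMap k A)] using this

theorem comul_antipode (ht : IsMultiplicative k t) (i j : ι) :
    Coalgebra.comul (R := k) (antipode k (t i j)) =
      ∑ l, antipode k (t l j) ⊗ₜ[k] antipode k (t i l) := by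
  let T : Matrix ι ι (A ⊗[k] A) := fun i j => Coalgebra.comul (R := k) (t i j)
  let X : Matrix ι ι (A ⊗[k] A) := fun i j => Coalgebra.comul (R := k) (antipode k (t i j))
  let Y : Matrix ι ι (A ⊗[k] A) := fun i j => ∑ l, antipode k (t l j) ⊗ₜ[k] antipode k (t i l)
  have h₁ : X * T = 1 := by
    ext i j
    have := congrArg (Bialgebra.comulAlgHom k A) (ht.sum_antipode_mul i j)
    simp only [map_sum, map_mul, Matrix.one_apply, apply_ite (Bialgebra.comulAlgHom k A),
      map_one, map_zero] at this
    rw [Matrix.mul_apply, Matrix.one_apply]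
    exact this
  have h₂ : T * Y = 1 := by
    ext i j
    have h : ∀ p q, ∑ l, (t i p ⊗ₜ[k] t p l) * (antipode k (t q j) ⊗ₜ[k] antipode k (t l q)) =
      (t i p * antipode k (t q j)) ⊗ₜ[k] (1 : Matrix ι ι A) p q := by
      intro p q
      simp only [Algebra.TensorProduct.tmul_mul_tmul, ← TensorProduct.tmul_sum,
        ht.sum_mul_antipode]
    calc (T * Y) i j = ∑ l, (∑ p, t i p ⊗ₜ[k] t p l) *
          ∑ q, antipode k (t q j) ⊗ₜ[k] antipode k (t l q) := by
            rw [Matrix.mul_apply]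
            simp only [T, Y, ht.comul]
      _ = ∑ p, ∑ q, ∑ l, (t i p ⊗ₜ[k] t p l) *
          (antipode k (t q j) ⊗ₜ[k] antipode k (t l q)) := by
            simp only [Finset.sum_mul_sum]
            rw [Finset.sum_comm]
            exact Finset.sum_congr rfl fun p _ => Finset.sum_comm
      _ = (1 : Matrix ι ι (A ⊗[k] A)) i j := by
            simp only [h, Matrix.one_apply, TensorProduct.tmul_ite,
              Finset.sum_ite_eq, Finset.mem_univ, if_true, ← TensorProduct.sum_tmul,
              ht.sum_mul_antipode, TensorProduct.ite_tmul, Algebra.TensorProduct.one_def]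
  exact congrArg (fun M : Matrix ι ι (A ⊗[k] A) => M i j) (left_inv_eq_right_inv h₁ h₂)

/-- The coefficient matrix of a tensor product of comodules. -/
theorem kronecker (ht : IsMultiplicative k t) (hs : IsMultiplicative k s) :
    IsMultiplicative k (Matrix.of fun p q : ι × κ => t p.1 q.1 * s p.2 q.2) where
  comul p q := by
    simp [Bialgebra.comul_mul, ht.comul, hs.comul, Finset.sum_mul_sum, Fintype.sum_prod_type]
  counit p q := by
    simp [Bialgebra.counit_mul, ht.counit, hs.counit, Matrix.one_apply, Prod.ext_iff, ite_and]
    split_ifs <;> rfl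

theorem fromBlocks (ht : IsMultiplicative k t) (hs : IsMultiplicative k s) :
    IsMultiplicative k (Matrix.fromBlocks t 0 0 s) where
  comul p q := by
    rcases p with i | i <;> rcases q with j | j <;> simp [ht.comul, hs.comul]
  counit p q := by
    rcases p with i | i <;> rcases q with j | j <;> simp [ht.counit, hs.counit, Matrix.one_apply]

end IsMultiplicative

theorem isMultiplicative_one : IsMultiplicative k (1 : Matrix Unit Unit A) where
  comul i j := by simp [Algebra.TensorProduct.one_def]
  counit i j := by simp

theorem IsComod.isMultiplicative {V : Type u} [AddCommGroup V] [Module k V]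
    {ρ : V →ₗ[k] V ⊗[k] A} (hρ : IsComod V ρ) {ι : Type*} [Fintype ι] [DecidableEq ι]
    {v : ι → V} (hv : LinearIndependent k v) {t : Matrix ι ι A}
    (ht : ∀ j, ρ (v j) = ∑ i, v i ⊗ₜ[k] t i j) : IsMultiplicative k t := by
  have hf : ∀ i, ∃ f : V →ₗ[k] k, ∀ j, f (v j) = if j = i then 1 else 0 := by
    intro i
    obtain ⟨f, hf⟩ := (Module.Basis.span hv).constr k
      (fun j => if j = i then (1 : k) else 0) |>.exists_extend
    refine ⟨f, fun j => ?_⟩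
    have := LinearMap.congr_fun hf (Module.Basis.span hv j)
    rw [Module.Basis.constr_basis] at this
    simpa [Module.Basis.span_apply] using this
  choose f hf using hf
  refine ⟨fun i j => ?_, fun i j => ?_⟩
  · have := LinearMap.congr_fun hρ.coassoc (v j)
    have := congrArg (fun x => TensorProduct.lid k _ (map (f i) LinearMap.id x)) this
    simp only [LinearMap.comp_apply, ht, map_sum, TensorProduct.map_tmul, LinearEquiv.coe_coe,
      LinearMap.id_apply, TensorProduct.sum_tmul, TensorProduct.assoc_tmul, TensorProduct.lid_tmul,
      hf, ite_smul, one_smul, zero_smul, Finset.sum_ite_eq', Finset.mem_univ, if_true] at this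
    exact this.symm
  · have := LinearMap.congr_fun hρ.counit_id (v j)
    have := congrArg (f i) this
    simp only [LinearMap.comp_apply, ht, map_sum, TensorProduct.map_tmul, LinearEquiv.coe_coe,
      LinearMap.id_apply, TensorProduct.rid_tmul, map_smul,
      hf, smul_eq_mul, mul_ite, mul_one, mul_zero, Finset.sum_ite_eq', Finset.mem_univ,
      if_true] at this
    rw [this, Matrix.one_apply]
    simp only [eq_comm]

theorem isComod_comul : IsComod (k := k) (A := A) A Coalgebra.comul where
  coassoc := Coalgebra.coassoc
  counit_id := by
    ext a
    have := Coalgebra.lTensor_counit_comul (R := k) a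
    simp only [LinearMap.comp_apply]
    change TensorProduct.rid k A (Coalgebra.counit.lTensor A _) = _
    rw [this]
    simp

theorem Fintype.sum_rotate {M ι κ μ : Type*} [AddCommMonoid M] [Fintype ι] [Fintype κ]
    [Fintype μ] (f : ι → κ → μ → M) :
    ∑ i, ∑ j, ∑ l, f i j l = ∑ l, ∑ i, ∑ j, f i j l := by
  rw [Finset.sum_comm (s := (Finset.univ : Finset μ))]
  exact Finset.sum_congr rfl fun i _ => Finset.sum_comm

theorem IsSubcomod.exists_isMultiplicative {V : Type u} [AddCommGroup V] [Module k V]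
    {ρ : V →ₗ[k] V ⊗[k] A} (hρ : IsComod V ρ) {W : Submodule k V} (hW : IsSubcomod ρ W)
    {n : ℕ} (b : Module.Basis (Fin n) k W) :
    ∃ t : Matrix (Fin n) (Fin n) A, IsMultiplicative k t ∧
      ∀ j, ρ (b j) = ∑ i, (b i : V) ⊗ₜ t i j := by
  have h : ∀ j, ∃ y : Fin n → A, ρ (b j) = ∑ i, (b i : V) ⊗ₜ y i := by
    intro j
    obtain ⟨x, hx⟩ := hW _ (b j).2
    rw [← hx]
    clear hx
    induction x with
    | zero => exact ⟨0, by simp⟩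
    | tmul w a =>
      refine ⟨fun i => b.repr w i • a, ?_⟩
      have hw := congrArg Subtype.val (b.sum_repr w)
      simp only [AddSubmonoidClass.coe_finsetSum, SetLike.val_smul] at hw
      simp only [TensorProduct.map_tmul, Submodule.coe_subtype, LinearMap.id_apply,
        ← TensorProduct.smul_tmul, ← TensorProduct.sum_tmul, hw]
    | add x y hx hy =>
      obtain ⟨x', hx⟩ := hx
      obtain ⟨y', hy⟩ := hy
      exact ⟨x' + y', by simp [hx, hy, TensorProduct.tmul_add, Finset.sum_add_distrib]⟩
  choose y hy using h
  refine ⟨Matrix.of fun i j => y j i, hρ.isMultiplicative (v := fun i => (b i : V)) ?_ hy, hy⟩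
  exact b.linearIndependent.map' W.subtype (Submodule.ker_subtype W)

/-- Every element of a Hopf algebra is a coefficient of a finite-dimensional comodule. -/
theorem exists_isMultiplicative_apply (a : A) :
    ∃ (n : ℕ) (t : Matrix (Fin n) (Fin n) A) (α : Matrix (Fin n) (Fin n) k),
      IsMultiplicative k t ∧ a = ∑ i, ∑ j, α i j • t i j := by
  classical
  let e := Module.Basis.ofVectorSpace k A
  let x := TensorProduct.equivFinsuppOfBasisRight e (Coalgebra.comul (R := k) a)
  have hx : Coalgebra.comul (R := k) a = ∑ l ∈ x.support, x l ⊗ₜ e l :=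
    ((TensorProduct.equivFinsuppOfBasisRight e).symm_apply_apply _).symm.trans
      (TensorProduct.equivFinsuppOfBasisRight_symm_apply _ _)
  obtain ⟨W, hWx⟩ : ∃ W : Submodule k A, W = Submodule.span k (x '' x.support) := ⟨_, rfl⟩
  have hxW : ∀ l ∈ x.support, x l ∈ W := fun l hl => hWx ▸ Submodule.subset_span ⟨l, hl, rfl⟩
  have : FiniteDimensional k W := hWx ▸
    FiniteDimensional.span_of_finite k (x.support.finite_toSet.image _)
  have hW : IsSubcomod (k := k) (A := A) Coalgebra.comul W := by
    intro w hw
    rw [hWx] at hw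
    induction hw using Submodule.span_induction with
    | zero => simp
    | add y z _ _ hy hz => rw [map_add]; exact add_mem hy hz
    | smul c y _ hy => rw [map_smul]; exact Submodule.smul_mem _ _ hy
    | mem y hy =>
      obtain ⟨m, hm, rfl⟩ := hy
      let q : A ⊗[k] (A ⊗[k] A) →ₗ[k] A ⊗[k] A :=
        (TensorProduct.rid k (A ⊗[k] A)).toLinearMap ∘ₗ map LinearMap.id (e.coord m) ∘ₗ
          (TensorProduct.assoc k A A A).symm.toLinearMap
      have hq : ∀ l ∈ x.support, ∀ z, q (x l ⊗ₜ z) ∈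
          LinearMap.range (map W.subtype (LinearMap.id : A →ₗ[k] A)) := by
        intro l hl z
        induction z with
        | zero => simp
        | tmul y z =>
          refine ⟨e.coord m z • (⟨x l, hxW l hl⟩ ⊗ₜ y), ?_⟩
          simp [q]
        | add y z hy hz => rw [TensorProduct.tmul_add, map_add]; exact add_mem hy hz
      have h₁ : q (Coalgebra.comul.lTensor A (Coalgebra.comul (R := k) a)) =
          Coalgebra.comul (x m) := by
        rw [← Coalgebra.coassoc_apply, hx]
        simp only [q, map_sum, LinearMap.rTensor_tmul, LinearMap.comp_apply, LinearEquiv.coe_coe,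
          LinearEquiv.symm_apply_apply, TensorProduct.map_tmul, TensorProduct.rid_tmul,
          LinearMap.id_apply, Module.Basis.coord_apply, Module.Basis.repr_self,
          Finsupp.single_apply, ite_smul, one_smul, zero_smul, Finset.sum_ite_eq']
        exact if_pos hm
      rw [← h₁, hx]
      simp only [map_sum, LinearMap.lTensor_tmul]
      exact sum_mem fun l hl => hq l hl _
  obtain ⟨t, ht, hb⟩ := hW.exists_isMultiplicative isComod_comul (Module.finBasis k W)
  have ha : a ∈ W := by
    have := Coalgebra.lTensor_counit_comul (R := k) a
    have := congrArg (TensorProduct.rid k A) this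
    simp only [hx, map_sum, LinearMap.lTensor_tmul, TensorProduct.rid_tmul, one_smul] at this
    rw [← this]
    exact sum_mem fun l hl => Submodule.smul_mem _ _ (hxW l hl)
  have hb' : ∀ j, (Module.finBasis k W j : A) =
      ∑ i, Coalgebra.counit (R := k) (Module.finBasis k W i : A) • t i j := by
    intro j
    have := Coalgebra.rTensor_counit_comul (R := k) (Module.finBasis k W j : A)
    have := congrArg (TensorProduct.lid k A) this
    rw [hb] at this
    simpa only [map_sum, LinearMap.rTensor_tmul, TensorProduct.lid_tmul, one_smul] using this.symm
  refine ⟨_, t, Matrix.of fun i j => (Module.finBasis k W).repr ⟨a, ha⟩ j •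
    Coalgebra.counit (R := k) (Module.finBasis k W i : A), ht, ?_⟩
  have := congrArg Subtype.val ((Module.finBasis k W).sum_repr ⟨a, ha⟩)
  simp only [AddSubmonoidClass.coe_finsetSum, SetLike.val_smul] at this
  rw [Finset.sum_comm]
  simp only [Matrix.of_apply, smul_assoc, ← Finset.smul_sum, ← hb', this]

variable {R : A ⊗[k] A →ₗ[k] k}

namespace IsMultiplicative

variable {ι κ : Type*} [Fintype ι] [DecidableEq ι] [Fintype κ] [DecidableEq κ]
  {t : Matrix ι ι A} {s : Matrix κ κ A}

theorem apply_antipode_left (ht : IsMultiplicative k t) (hs : IsMultiplicative k s)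
    (hR : IsCT (mul' k A) R) (i j : ι) (p q : κ) :
    R (antipode k (t i j) ⊗ₜ s p q) = R (s p q ⊗ₜ t i j) := by
  let M : Matrix (ι × κ) (ι × κ) k := fun x y => R (t x.1 y.1 ⊗ₜ s x.2 y.2)
  let M' : Matrix (ι × κ) (ι × κ) k := fun x y => R (antipode k (t x.1 y.1) ⊗ₜ s x.2 y.2)
  let N : Matrix (ι × κ) (ι × κ) k := fun x y => R (s x.2 y.2 ⊗ₜ t x.1 y.1)
  have h₁ : M * M' = 1 := by
    ext ⟨i, p⟩ ⟨j, q⟩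
    rw [Matrix.mul_apply, Fintype.sum_prod_type]
    simp only [M, M', ← hR.apply_mul_left _ _ (hs.comul p q)]
    rw [← map_sum, ← TensorProduct.sum_tmul, ht.sum_mul_antipode]
    by_cases h : i = j
    · subst h
      simp [hR.unit_left, hs.counit, Matrix.one_apply]
    · simp [h]
  have h₂ : M * N = 1 := by
    ext ⟨i, p⟩ ⟨j, q⟩
    have := LinearMap.congr_fun hR.tri_right (t i j ⊗ₜ s p q)
    rw [conv2_of_comul (ht.comul i j) (hs.comul p q)] at this
    rw [Matrix.mul_apply, Fintype.sum_prod_type]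
    simpa [eps2, ht.counit, hs.counit, Matrix.one_apply, Prod.ext_iff, ite_and, and_comm]
      using this
  exact congrArg (fun X : Matrix (ι × κ) (ι × κ) k => X (i, p) (j, q))
    (left_inv_eq_right_inv (mul_eq_one_comm.mp h₁) h₂)

theorem map_drinfeld_apply (ht : IsMultiplicative k t) (i j : ι) :
    drinfeld R (t i j) = ∑ l, R (t l j ⊗ₜ antipode k (t i l)) :=
  drinfeld_of_comul (ht.comul i j)

theorem map_drinfeldInv_apply (ht : IsMultiplicative k t) (i j : ι) :
    drinfeldInv R (t i j) = ∑ l, R (t i l ⊗ₜ antipode k (t l j)) :=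
  drinfeldInv_of_comul (ht.comul i j)

theorem trace_map_drinfeld (ht : IsMultiplicative k t) :
    (t.map (drinfeld R)).trace = (t.map (drinfeldInv R)).trace := by
  simp only [Matrix.trace, Matrix.diag_apply, Matrix.map_apply, ht.map_drinfeld_apply,
    ht.map_drinfeldInv_apply]
  exact Finset.sum_comm

theorem drinfeld_smul_one (ht : IsMultiplicative k t) (hR : IsCQT (mul' k A) R) (i j : ι) :
    drinfeld R (t i j) • (1 : A) =
      ∑ m, ∑ l, drinfeld R (t m l) • (t l j * antipode k (t i m)) := by
  have h := fun p => hR.mul_comm_of_comul (ht.comul p j) (ht.comul_antipode i p)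
  replace h := Finset.sum_congr (s₁ := Finset.univ) rfl fun p _ => h p
  have hl : ∑ p, ∑ l, ∑ r, R (t l j ⊗ₜ antipode k (t i r)) • (antipode k (t r p) * t p l) =
      drinfeld R (t i j) • (1 : A) := by
    rw [Finset.sum_comm]
    simp only [Finset.sum_comm (s := Finset.univ) (γ := ι) (t := Finset.univ)
      (f := fun p r => R (_ ⊗ₜ antipode k (t i r)) • (antipode k (t r p) * t p _)),
      ← Finset.smul_sum, ht.sum_antipode_mul, Matrix.one_apply, smul_ite, smul_zero,
      Finset.sum_ite_eq', Finset.mem_univ, if_true, ← Finset.sum_smul, ht.map_drinfeld_apply]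
  rw [← hl, h]
  simp only [ht.map_drinfeld_apply, Finset.sum_smul]
  rw [Fintype.sum_rotate]
  exact Finset.sum_congr rfl fun m _ => Finset.sum_comm

/-- The square of the antipode is conjugation by the Drinfeld element. -/
theorem sum_drinfeld_smul (ht : IsMultiplicative k t) (hR : IsCQT (mul' k A) R) (i j : ι) :
    ∑ l, drinfeld R (t i l) • t l j =
      ∑ l, drinfeld R (t l j) • antipode k (antipode k (t i l)) := by
  have h : ∀ l m p, t m j * antipode k (t l p) * antipode k (antipode k (t i l)) =
      t m j * antipode k (antipode k (t i l) * t l p) := by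
    intro l m p
    rw [HopfAlgebra.antipode_mul_antidistrib, mul_assoc]
  symm
  calc ∑ l, drinfeld R (t l j) • antipode k (antipode k (t i l))
      = ∑ l, (drinfeld R (t l j) • (1 : A)) * antipode k (antipode k (t i l)) := by simp
    _ = ∑ l, ∑ p, ∑ m, drinfeld R (t p m) • (t m j * antipode k (antipode k (t i l) * t l p)) := by
        simp only [ht.drinfeld_smul_one hR, Finset.sum_mul, smul_mul_assoc, h]
    _ = ∑ p, ∑ m, ∑ l, drinfeld R (t p m) • (t m j * antipode k (antipode k (t i l) * t l p)) := by
        rw [Finset.sum_comm]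
        exact Finset.sum_congr rfl fun p _ => Finset.sum_comm
    _ = _ := by
        simp only [← Finset.smul_sum, ← Finset.mul_sum, ← map_sum, ht.sum_antipode_mul]
        rw [Finset.sum_comm]
        simp [Matrix.one_apply, apply_ite (antipode k), HopfAlgebra.antipode_one]

end IsMultiplicative

theorem IsCT.apply_antipode_left (hR : IsCT (mul' k A) R) (a b : A) :
    R (antipode k a ⊗ₜ b) = R (b ⊗ₜ a) := by
  obtain ⟨_, t, α, ht, rfl⟩ := exists_isMultiplicative_apply (k := k) a
  have h : ∀ i j, R (antipode k (t i j) ⊗ₜ b) = R (b ⊗ₜ t i j) := by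
    intro i j
    obtain ⟨_, s, β, hs, rfl⟩ := exists_isMultiplicative_apply (k := k) b
    simp only [map_sum, TensorProduct.sum_tmul, TensorProduct.tmul_sum, map_smul,
      ← TensorProduct.smul_tmul', TensorProduct.tmul_smul, ht.apply_antipode_left hs hR]
  simp only [map_sum, TensorProduct.sum_tmul, TensorProduct.tmul_sum, map_smul,
    ← TensorProduct.smul_tmul', TensorProduct.tmul_smul, h]

theorem IsCT.apply_antipode_antipode (hR : IsCT (mul' k A) R) (a b : A) :
    R (antipode k a ⊗ₜ antipode k b) = R (a ⊗ₜ b) := by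
  rw [hR.apply_antipode_left, hR.apply_antipode_left]

namespace IsMultiplicative

variable {ι κ : Type*} [Fintype ι] [DecidableEq ι] [Fintype κ] [DecidableEq κ]
  {t : Matrix ι ι A} {s : Matrix κ κ A}

theorem sum_drinfeld_mul_apply (ht : IsMultiplicative k t) (hR : IsCQT (mul' k A) R)
    (f : A →ₗ[k] k) (i j : ι) :
    ∑ l, drinfeld R (t i l) * f (t l j) =
      ∑ l, drinfeld R (t l j) * f (antipode k (antipode k (t i l))) := by
  simpa [map_sum] using congrArg f (ht.sum_drinfeld_smul hR i j)

theorem map_drinfeld_mul_map_drinfeldInv (ht : IsMultiplicative k t) (hR : IsCT (mul' k A) R) :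
    t.map (drinfeld R) * t.map (drinfeldInv R) = 1 := by
  ext i j
  have h : ∀ q, ∑ l, drinfeld R (t i l) * R (t l q ⊗ₜ antipode k (t q j)) =
      ∑ l, drinfeld R (t l q) * R (antipode k (t i l) ⊗ₜ t q j) := by
    intro q
    have := ht.sum_drinfeld_mul_apply hR.toIsCQT
      (R ∘ₗ (TensorProduct.mk k A A).flip (antipode k (t q j))) i q
    simpa [hR.apply_antipode_antipode] using this
  have hm : ∀ m, ∑ q, ∑ l, R (t m q ⊗ₜ antipode k (t l m)) * R (antipode k (t i l) ⊗ₜ t q j) =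
      (1 : Matrix ι ι k) i m * (1 : Matrix ι ι k) m j := by
    intro m
    have := LinearMap.congr_fun hR.tri_right (t m j ⊗ₜ antipode k (t i m))
    rw [conv2_of_comul (ht.comul m j) (ht.comul_antipode i m)] at this
    simpa [eps2, ht.counit] using this
  calc (t.map (drinfeld R) * t.map (drinfeldInv R)) i j
      = ∑ q, ∑ l, drinfeld R (t i l) * R (t l q ⊗ₜ antipode k (t q j)) := by
        simp only [Matrix.mul_apply, Matrix.map_apply, ht.map_drinfeldInv_apply, Finset.mul_sum]
        exact Finset.sum_comm
    _ = ∑ q, ∑ l, ∑ m,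
          R (t m q ⊗ₜ antipode k (t l m)) * R (antipode k (t i l) ⊗ₜ t q j) := by
        simp only [h]
        simp only [ht.map_drinfeld_apply, Finset.sum_mul]
    _ = ∑ m, ∑ q, ∑ l,
          R (t m q ⊗ₜ antipode k (t l m)) * R (antipode k (t i l) ⊗ₜ t q j) :=
        Fintype.sum_rotate _
    _ = (1 : Matrix ι ι k) i j := by
        simp only [hm]
        rw [← Matrix.mul_apply, mul_one]

theorem drinfeld_mul (ht : IsMultiplicative k t) (hs : IsMultiplicative k s)
    (hR : IsCT (mul' k A) R) (i j : ι) (p q : κ) :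
    drinfeld R (t i j * s p q) = drinfeld R (t i j) * drinfeld R (s p q) := by
  let a : ι → ι → ι → k := fun m x z => R (t m x ⊗ₜ antipode k (t z m))
  let b : κ → κ → ι → k := fun n y z => R (s n y ⊗ₜ antipode k (t i z))
  let c : ι → κ → κ → k := fun x w n => R (t x j ⊗ₜ antipode k (s w n))
  let c' : ι → ι → κ → κ → k := fun z x w n => R (antipode k (t z x) ⊗ₜ s w n)
  let d : κ → κ → k := fun y w => R (s y q ⊗ₜ antipode k (s p w))
  have expand : ∀ m n, R ((t m j * s n q) ⊗ₜ (antipode k (s p n) * antipode k (t i m))) =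
      ∑ x, ∑ y, ∑ z, ∑ w, a m x z * b n y z * (c x w n * d y w) := by
    intro m n
    have := hR.apply_mul_right ((ht.kronecker hs).comul (m, n) (j, q))
      (antipode k (s p n)) (antipode k (t i m))
    simp only [Matrix.of_apply, Fintype.sum_prod_type,
      hR.apply_mul_left _ _ (ht.comul_antipode i m),
      hR.apply_mul_left _ _ (hs.comul_antipode p n), Finset.sum_mul_sum] at this
    exact this
  have reorder : ∑ m, ∑ n, ∑ x, ∑ y, ∑ z, ∑ w, a m x z * b n y z * (c x w n * d y w) =
      ∑ w, ∑ y, ∑ n, ∑ z, ∑ x, ∑ m, a m x z * c x w n * (b n y z * d y w) := by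
    have := Fintype.sum_equiv
      (⟨fun v => (v.2.2.2.2.2, v.2.2.2.1, v.2.1, v.2.2.2.2.1, v.2.2.1, v.1),
        fun v => (v.2.2.2.2.2, v.2.2.1, v.2.2.2.2.1, v.2.1, v.2.2.2.1, v.1),
        fun _ => rfl, fun _ => rfl⟩ : ι × κ × ι × κ × ι × κ ≃ κ × κ × κ × ι × ι × ι)
      (fun v => a v.1 v.2.2.1 v.2.2.2.2.1 * b v.2.1 v.2.2.2.1 v.2.2.2.2.1 *
        (c v.2.2.1 v.2.2.2.2.2 v.2.1 * d v.2.2.2.1 v.2.2.2.2.2))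
      (fun v => a v.2.2.2.2.2 v.2.2.2.2.1 v.2.2.2.1 * c v.2.2.2.2.1 v.1 v.2.2.1 *
        (b v.2.2.1 v.2.1 v.2.2.2.1 * d v.2.1 v.1))
      (fun v => mul_mul_mul_comm _ _ _ _)
    simpa only [Fintype.sum_prod_type] using this
  have conj : ∀ z w n, ∑ x, ∑ m, a m x z * c x w n = ∑ x, drinfeld R (t x j) * c' z x w n := by
    intro z w n
    have := ht.sum_drinfeld_mul_apply hR.toIsCQT
      (R ∘ₗ (TensorProduct.mk k A A).flip (antipode k (s w n))) z j
    simpa [hR.apply_antipode_antipode, a, c, c', ht.map_drinfeld_apply, Finset.sum_mul] using this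
  have cancel : ∀ w y x, ∑ n, ∑ z, c' z x w n * b n y z =
      (1 : Matrix κ κ k) w y * (1 : Matrix ι ι k) i x := by
    intro w y x
    have := LinearMap.congr_fun hR.tri_left (s w y ⊗ₜ antipode k (t i x))
    rw [conv2_of_comul (hs.comul w y) (ht.comul_antipode i x)] at this
    simpa [eps2, ht.counit, hs.counit, mul_comm] using this
  calc drinfeld R (t i j * s p q)
      = ∑ m, ∑ n, R ((t m j * s n q) ⊗ₜ (antipode k (s p n) * antipode k (t i m))) := by
        have := (ht.kronecker hs).map_drinfeld_apply (R := R) (i, p) (j, q)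
        simpa only [Matrix.of_apply, Fintype.sum_prod_type,
          HopfAlgebra.antipode_mul_antidistrib] using this
    _ = ∑ w, ∑ y, ∑ n, ∑ z, (∑ x, ∑ m, a m x z * c x w n) * (b n y z * d y w) := by
        simp only [expand, reorder, Finset.sum_mul]
    _ = ∑ w, ∑ y, ∑ n, ∑ z, ∑ x, drinfeld R (t x j) * (c' z x w n * b n y z) * d y w := by
        simp only [conj, Finset.sum_mul, mul_assoc]
    _ = ∑ w, ∑ y, ∑ x, drinfeld R (t x j) * (∑ n, ∑ z, c' z x w n * b n y z) * d y w := by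
        refine Finset.sum_congr rfl fun w _ => Finset.sum_congr rfl fun y _ => ?_
        rw [Fintype.sum_rotate]
        simp only [Finset.mul_sum, Finset.sum_mul]
    _ = drinfeld R (t i j) * ∑ w, d w w := by
        simp [cancel, Matrix.one_apply, Finset.mul_sum]
    _ = drinfeld R (t i j) * drinfeld R (s p q) := by
        rw [hs.map_drinfeld_apply]

theorem antipode_antipode (ht : IsMultiplicative k t) (hR : IsCT (mul' k A) R) (f : A →ₗ[k] k) :
    t.map (f ∘ₗ antipode k ∘ₗ antipode k) =
      t.map (drinfeld R) * t.map f * t.map (drinfeldInv R) := by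
  have : t.map (drinfeld R) * t.map f =
      t.map (f ∘ₗ antipode k ∘ₗ antipode k) * t.map (drinfeld R) := by
    ext i j
    simp only [Matrix.mul_apply, Matrix.map_apply, ht.sum_drinfeld_mul_apply hR.toIsCQT]
    exact Finset.sum_congr rfl fun l _ => mul_comm _ _
  rw [this, mul_assoc, ht.map_drinfeld_mul_map_drinfeldInv hR, mul_one]

end IsMultiplicative

theorem drinfeld_one (hR : IsCQT (mul' k A) R) : drinfeld R (1 : A) = 1 := by
  simp [drinfeld, Algebra.TensorProduct.one_def, HopfAlgebra.antipode_one, hR.unit_right]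

theorem Matrix.trace_mulLeft_mul_mulRight {n : Type*} [Fintype n] [DecidableEq n]
    (P Q : Matrix n n k) :
    LinearMap.trace k (Matrix n n k) (mulLeft k P * mulRight k Q) = P.trace * Q.trace := by
  rw [LinearMap.trace_eq_matrix_trace k (Matrix.stdBasis k n n), Matrix.trace,
    Fintype.sum_prod_type]
  simp only [Matrix.diag_apply, LinearMap.toMatrix_apply, Matrix.stdBasis_eq_single,
    Matrix.trace, Finset.sum_mul_sum]
  refine Finset.sum_congr rfl fun i _ => Finset.sum_congr rfl fun j _ => ?_
  simp [Matrix.stdBasis, Matrix.mul_apply, Matrix.single_apply, ite_and]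

theorem TensorProduct.eq_of_pairForm {x y : A ⊗[k] A}
    (h : ∀ f g : A →ₗ[k] k, pairForm f g x = pairForm f g y) : x = y := by
  let e := Module.Basis.ofVectorSpace k A
  have hpf : ∀ (i j) (z : A ⊗[k] A),
      (e.tensorProduct e).repr z (i, j) = pairForm (e.coord i) (e.coord j) z := by
    intro i j z
    induction z with
    | zero => simp
    | tmul a b => simp [pairForm, mul_comm]
    | add z w hz hw => simp [hz, hw]
  refine (e.tensorProduct e).ext_elem fun ⟨i, j⟩ => ?_
  rw [hpf, hpf, h]

namespace IsMultiplicative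

section

variable {ι : Type*} [Fintype ι] [DecidableEq ι] {t : Matrix ι ι A}

/-- The matrix algebra spanned by the action of `A*` on the comodule with coefficient matrix
`t`. -/
def actionAlgebra (ht : IsMultiplicative k t) : Subalgebra k (Matrix ι ι k) where
  carrier := Set.range fun f : A →ₗ[k] k => t.map f
  mul_mem' := by
    rintro _ _ ⟨f, rfl⟩ ⟨g, rfl⟩
    exact ⟨conv1 f g, ht.map_conv1 f g⟩
  add_mem' := by
    rintro _ _ ⟨f, rfl⟩ ⟨g, rfl⟩
    exact ⟨f + g, by ext; simp⟩
  algebraMap_mem' r := by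
    refine ⟨r • Coalgebra.counit, ?_⟩
    ext i j
    simp [ht.counit, Matrix.algebraMap_matrix_apply, Matrix.one_apply]

/-- The action of `f ∈ A*` as an element of the action algebra. -/
def action (ht : IsMultiplicative k t) : (A →ₗ[k] k) →ₗ[k] ht.actionAlgebra where
  toFun f := ⟨t.map f, f, rfl⟩
  map_add' f g := by ext; rfl
  map_smul' r f := by ext; rfl

@[simp]
theorem coe_action (ht : IsMultiplicative k t) (f : A →ₗ[k] k) :
    (ht.action f : Matrix ι ι k) = t.map f := rfl

theorem action_surjective (ht : IsMultiplicative k t) : Function.Surjective ht.action := by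
  rintro ⟨_, f, rfl⟩
  exact ⟨f, rfl⟩

theorem action_conv1 (ht : IsMultiplicative k t) (f g : A →ₗ[k] k) :
    ht.action (conv1 f g) = ht.action f * ht.action g :=
  Subtype.ext (ht.map_conv1 f g)

theorem action_counit (ht : IsMultiplicative k t) : ht.action Coalgebra.counit = 1 :=
  Subtype.ext ht.map_counit

theorem antipode_antipode_apply (ht : IsMultiplicative k t) (hR : IsCT (mul' k A) R) (i j : ι) :
    antipode k (antipode k (t i j)) =
      ∑ l, ∑ m, (drinfeld R (t i m) * drinfeldInv R (t l j)) • t m l := by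
  rw [← sub_eq_zero, ← Module.forall_dual_apply_eq_zero_iff k]
  intro f
  rw [map_sub, sub_eq_zero]
  have := congrFun₂ (ht.antipode_antipode hR f) i j
  simp only [Matrix.map_apply, LinearMap.comp_apply, Matrix.mul_apply, Finset.sum_mul] at this
  simp only [this, map_sum, map_smul, smul_eq_mul, mul_right_comm]

/-- The subcoalgebra spanned by the entries of `t`. -/
def coeffSpan (k : Type u) {A : Type u} [Field k] [Ring A] [HopfAlgebra k A]
    {ι : Type*} (t : Matrix ι ι A) : Submodule k A :=
  Submodule.span k (Set.range fun p : ι × ι => t p.1 p.2)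

theorem mem_coeffSpan {ι : Type*} (t : Matrix ι ι A) (i j : ι) : t i j ∈ coeffSpan k t :=
  Submodule.subset_span ⟨(i, j), rfl⟩

theorem comul_mem_of_mem_coeffSpan (ht : IsMultiplicative k t) {a : A} (ha : a ∈ coeffSpan k t) :
    Coalgebra.comul a ∈
      LinearMap.range (map (coeffSpan k t).subtype (coeffSpan k t).subtype) := by
  induction ha using Submodule.span_induction with
  | zero => simp
  | add y z _ _ hy hz => rw [map_add]; exact add_mem hy hz
  | smul c y _ hy => rw [map_smul]; exact Submodule.smul_mem _ _ hy
  | mem y hy =>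
    obtain ⟨⟨i, j⟩, rfl⟩ := hy
    refine ⟨∑ l, ⟨t i l, mem_coeffSpan t i l⟩ ⊗ₜ ⟨t l j, mem_coeffSpan t l j⟩, ?_⟩
    simp [ht.comul]

theorem antipode_antipode_mem_coeffSpan (ht : IsMultiplicative k t) (hR : IsCT (mul' k A) R)
    {a : A} (ha : a ∈ coeffSpan k t) : (antipode k ∘ₗ antipode k) a ∈ coeffSpan k t := by
  induction ha using Submodule.span_induction with
  | zero => simp
  | add y z _ _ hy hz => rw [map_add]; exact add_mem hy hz
  | smul c y _ hy => rw [map_smul]; exact Submodule.smul_mem _ _ hy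
  | mem y hy =>
    obtain ⟨⟨i, j⟩, rfl⟩ := hy
    simp only [LinearMap.comp_apply, ht.antipode_antipode_apply hR]
    exact sum_mem fun l _ => sum_mem fun m _ => Submodule.smul_mem _ _ (mem_coeffSpan t m l)

/-- Evaluation at the entries of `t` of linear forms on the coefficient coalgebra. -/
def dualToAction (ht : IsMultiplicative k t) :
    Module.Dual k (coeffSpan k t) →ₗ[k] ht.actionAlgebra where
  toFun φ := ⟨Matrix.of fun i j => φ ⟨t i j, mem_coeffSpan t i j⟩, (by
    obtain ⟨f, hf⟩ := LinearMap.exists_extend φ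
    refine ⟨f, ?_⟩
    rw [← hf]
    rfl)⟩
  map_add' φ ψ := by ext; rfl
  map_smul' r φ := by ext; rfl

/-- The dual of the coefficient coalgebra is the action algebra. -/
def dualEquiv (ht : IsMultiplicative k t) :
    Module.Dual k (coeffSpan k t) ≃ₗ[k] ht.actionAlgebra :=
  LinearEquiv.ofBijective ht.dualToAction (by
    refine ⟨fun φ ψ h => ?_, ?_⟩
    · obtain ⟨f, rfl⟩ := LinearMap.exists_extend φ
      obtain ⟨g, rfl⟩ := LinearMap.exists_extend ψ
      have h' : ∀ a ∈ coeffSpan k t, f a = g a := fun a ha => by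
        refine LinearMap.eqOn_span (s := Set.range fun p : ι × ι => t p.1 p.2) ?_ ha
        rintro _ ⟨⟨i, j⟩, rfl⟩
        exact congrFun₂ (congrArg Subtype.val h) i j
      ext ⟨a, ha⟩
      exact h' a ha
    · rintro ⟨_, f, rfl⟩
      exact ⟨f ∘ₗ (coeffSpan k t).subtype, rfl⟩)

theorem trace_mulLeft_mul_mulRight_action (ht : IsMultiplicative k t) (hR : IsCT (mul' k A) R)
    (hpi : Pseudoinvolutive k A) :
    LinearMap.trace k ht.actionAlgebra
        (mulLeft k (ht.action (drinfeld R)) * mulRight k (ht.action (drinfeldInv R))) =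
      (Module.finrank k ht.actionAlgebra : k) := by
  have hfin : FiniteDimensional k (coeffSpan k t) :=
    FiniteDimensional.span_of_finite k (Set.finite_range _)
  let T := (antipode k ∘ₗ antipode k).restrict
    fun x (hx : x ∈ coeffSpan k t) => ht.antipode_antipode_mem_coeffSpan hR hx
  have hT : LinearMap.trace k _ T = _ := hpi _ hfin (fun c hc => ht.comul_mem_of_mem_coeffSpan hc)
    fun x (hx : x ∈ coeffSpan k t) => ht.antipode_antipode_mem_coeffSpan hR hx
  rw [← ht.dualEquiv.finrank_eq, Subspace.dual_finrank_eq, ← hT, ← LinearMap.trace_transpose' T,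
    ← LinearMap.trace_conj' _ ht.dualEquiv]
  congr 1
  refine LinearMap.ext fun x => ?_
  obtain ⟨φ, rfl⟩ := ht.dualEquiv.surjective x
  obtain ⟨f, rfl⟩ := LinearMap.exists_extend φ
  rw [LinearEquiv.conj_apply_apply, LinearEquiv.symm_apply_apply]
  exact Subtype.ext ((mul_assoc _ _ _).symm.trans (ht.antipode_antipode hR f).symm)

end

theorem exists_isMultiplicative_of_algHom {ι : Type*} [Fintype ι] [DecidableEq ι]
    {t : Matrix ι ι A} (ht : IsMultiplicative k t) {d : ℕ}
    (π : ht.actionAlgebra →ₐ[k] Matrix (Fin d) (Fin d) k) :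
    ∃ s : Matrix (Fin d) (Fin d) A, IsMultiplicative k s ∧
      ∀ f : A →ₗ[k] k, s.map f = π (ht.action f) := by
  have hF : ∀ i j, ∃ F : Matrix ι ι k →ₗ[k] k, ∀ x : ht.actionAlgebra, F x = π x i j := by
    intro i j
    obtain ⟨F, hF⟩ := LinearMap.exists_extend (p := ht.actionAlgebra.toSubmodule)
      (Matrix.entryLinearMap k k i j ∘ₗ π.toLinearMap)
    exact ⟨F, fun x => LinearMap.congr_fun hF x⟩
  choose F hF using hF
  have hFs : ∀ i j x, F i j x = ∑ p, ∑ q, F i j (Matrix.single p q 1) * x p q := by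
    intro i j x
    conv_lhs => rw [Matrix.matrix_eq_sum_single x]
    simp only [map_sum]
    refine Finset.sum_congr rfl fun p _ => Finset.sum_congr rfl fun q _ => ?_
    rw [mul_comm, ← smul_eq_mul, ← map_smul, Matrix.smul_single, smul_eq_mul, mul_one]
  let s : Matrix (Fin d) (Fin d) A :=
    Matrix.of fun i j => ∑ p, ∑ q, F i j (Matrix.single p q 1) • t p q
  have hs : ∀ (f : A →ₗ[k] k) i j, f (s i j) = π (ht.action f) i j := by
    intro f i j
    rw [← hF, hFs]
    simp [s, map_sum]
  refine ⟨s, ⟨fun i j => ?_, fun i j => ?_⟩, fun f => Matrix.ext fun i j => hs f i j⟩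
  · refine TensorProduct.eq_of_pairForm fun f g => ?_
    have := hs (conv1 f g) i j
    rw [ht.action_conv1, map_mul, Matrix.mul_apply] at this
    simp only [← hs] at this
    change conv1 f g (s i j) = _
    simp [this, pairForm]
  · rw [hs, ht.action_counit, map_one]

variable {ι : Type*} [Fintype ι] [DecidableEq ι] {t : Matrix ι ι A}

theorem trace_algHom_action (ht : IsMultiplicative k t) (hR : IsCT (mul' k A) R)
    (hpi : Pseudoinvolutive k A) (d : ℕ)
    (π : ht.actionAlgebra →ₐ[k] Matrix (Fin d) (Fin d) k) (hπ : Function.Surjective π) :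
    (π (ht.action (drinfeld R))).trace = (π (ht.action (drinfeldInv R))).trace ∧
      (π (ht.action (drinfeld R))).trace * (π (ht.action (drinfeldInv R))).trace = (d : k) * d := by
  obtain ⟨s, hs, h⟩ := ht.exists_isMultiplicative_of_algHom π
  rw [← h, ← h]
  refine ⟨hs.trace_map_drinfeld, ?_⟩
  have htop : hs.actionAlgebra = ⊤ := by
    refine eq_top_iff.mpr fun x _ => ?_
    obtain ⟨y, rfl⟩ := hπ x
    obtain ⟨f, rfl⟩ := ht.action_surjective y
    exact ⟨f, h f⟩
  let E : hs.actionAlgebra ≃ₗ[k] Matrix (Fin d) (Fin d) k :=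
    LinearEquiv.ofTop hs.actionAlgebra.toSubmodule (by rw [htop]; rfl)
  have := hs.trace_mulLeft_mul_mulRight_action hR hpi
  rw [E.finrank_eq, ← LinearMap.trace_conj' _ E] at this
  rw [← Matrix.trace_mulLeft_mul_mulRight]
  refine Eq.trans ?_ (this.trans ?_)
  · congr 1
  · simp [Module.finrank_matrix]

/-- `e ∈ A*` is a parity form for `t` if it acts through `t` by a central involution with the
same traces as the Drinfeld element. -/
structure IsParity (R : A ⊗[k] A →ₗ[k] k) (t : Matrix ι ι A) (e : A →ₗ[k] k) : Prop where
  mul_self : t.map e * t.map e = 1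
  comm : ∀ f : A →ₗ[k] k, t.map e * t.map f = t.map f * t.map e
  trace_mul : ∀ y : Matrix ι ι k, (∀ f : A →ₗ[k] k, y * t.map f = t.map f * y) →
    (t.map (drinfeld R) * y).trace = (t.map e * y).trace

theorem exists_isParity [IsAlgClosed k] [CharZero k] (ht : IsMultiplicative k t)
    (hR : IsCT (mul' k A) R) (hpi : Pseudoinvolutive k A) : ∃ e, IsParity R t e := by
  obtain ⟨c, hc, hcomm, hφ⟩ := exists_central_involution (k := k) _ _
    (ht.trace_algHom_action hR hpi) (ht.trace_mulLeft_mul_mulRight_action hR hpi)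
  obtain ⟨e, rfl⟩ := ht.action_surjective c
  refine ⟨e, congrArg Subtype.val hc, fun f => congrArg Subtype.val (hcomm (ht.action f)),
    fun y hy => ?_⟩
  have hy' : ∀ x : ht.actionAlgebra, Commute y x := by
    rintro ⟨_, f, rfl⟩
    exact hy f
  refine hφ (Matrix.traceLinearMap ι k k ∘ₗ LinearMap.mulRight k y ∘ₗ
    ht.actionAlgebra.val.toLinearMap) (fun a b => ?_) (fun a ha => ?_)
  · change ((a : Matrix ι ι k) * b * y).trace = ((b : Matrix ι ι k) * a * y).trace
    rw [mul_assoc, Matrix.trace_mul_comm, mul_assoc, (hy' a).eq, ← mul_assoc]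
  · change ((a : Matrix ι ι k) * y).trace = 0
    have : IsNilpotent ((a : Matrix ι ι k) * y) :=
      (hy' a).symm.isNilpotent_mul_right (ha.map ht.actionAlgebra.val)
    exact (Matrix.isNilpotent_trace_of_isNilpotent this).eq_zero

end IsMultiplicative

theorem Matrix.eq_zero_of_mul_self_of_trace_eq_zero {ι : Type*} [Fintype ι] [DecidableEq ι]
    [CharZero k] {z : Matrix ι ι k} {r : k} (hr : r ≠ 0) (hz : z * z = r • z)
    (h : z.trace = 0) : z = 0 := by
  have hi : IsIdempotentElem (Matrix.toLinAlgEquiv' (r⁻¹ • z)) := by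
    refine IsIdempotentElem.map ?_ _
    rw [IsIdempotentElem, smul_mul_smul_comm, hz, smul_smul, mul_assoc, inv_mul_cancel₀ hr, mul_one]
  have h0 := LinearMap.IsIdempotentElem.eq_zero_of_trace_eq_zero hi (by
    change LinearMap.trace k _ (Matrix.toLin' _) = 0
    rw [Matrix.trace_toLin'_eq, Matrix.trace_smul, h, smul_zero])
  rw [map_eq_zero_iff _ (AlgEquiv.injective _)] at h0
  exact (smul_eq_zero.mp h0).resolve_left (inv_ne_zero hr)

theorem eq_of_eqOn_coeffSpan {ι : Type*} {t : Matrix ι ι A} {f g : A →ₗ[k] k}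
    (h : t.map f = t.map g) {a : A} (ha : a ∈ IsMultiplicative.coeffSpan k t) : f a = g a := by
  refine LinearMap.eqOn_span (s := Set.range fun p : ι × ι => t p.1 p.2) ?_ ha
  rintro _ ⟨⟨i, j⟩, rfl⟩
  exact congrFun₂ h i j

theorem exists_isMultiplicative_mem_coeffSpan (k : Type u) {A : Type u} [Field k] [Ring A]
    [HopfAlgebra k A] (a : A) :
    ∃ (n : ℕ) (t : Matrix (Fin n) (Fin n) A),
      IsMultiplicative k t ∧ a ∈ IsMultiplicative.coeffSpan k t := by
  obtain ⟨n, t, α, ht, ha⟩ := exists_isMultiplicative_apply (k := k) a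
  refine ⟨n, t, ht, ha ▸ ?_⟩
  exact sum_mem fun i _ => sum_mem fun j _ =>
    Submodule.smul_mem _ _ (IsMultiplicative.mem_coeffSpan t i j)

theorem linearForm_ext {f g : A →ₗ[k] k}
    (h : ∀ (n : ℕ) (t : Matrix (Fin n) (Fin n) A), IsMultiplicative k t → t.map f = t.map g) :
    f = g := by
  refine LinearMap.ext fun a => ?_
  obtain ⟨n, t, ht, ha⟩ := exists_isMultiplicative_mem_coeffSpan k a
  exact eq_of_eqOn_coeffSpan (h n t ht) ha

namespace IsMultiplicative.IsParity

variable {ι κ : Type*} [Fintype ι] [DecidableEq ι] [Fintype κ] [DecidableEq κ]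
  {t : Matrix ι ι A} {s : Matrix κ κ A} {e e' : A →ₗ[k] k}

theorem of_map_eq (h : IsParity R t e) (he : t.map e' = t.map e) : IsParity R t e' :=
  ⟨he ▸ h.mul_self, he ▸ h.comm, he ▸ h.trace_mul⟩

/-- A parity form acts as the sign `σ` on the image of an equivariant idempotent as soon as the
Drinfeld element has trace `σ` times the rank there. -/
theorem map_mul_eq_smul [CharZero k] (h : IsParity R t e) {p : Matrix ι ι k} {r σ : k}
    (hr : r ≠ 0) (hσ : σ * σ = 1) (hp : p * p = r • p)
    (hpc : ∀ f : A →ₗ[k] k, p * t.map f = t.map f * p)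
    (htr : (t.map (drinfeld R) * p).trace = σ * p.trace) : t.map e * p = σ • p := by
  have hz : p - σ • (t.map e * p) = 0 := by
    refine Matrix.eq_zero_of_mul_self_of_trace_eq_zero (mul_ne_zero two_ne_zero hr) ?_ ?_
    · have h₁ : p * (t.map e * p) = r • (t.map e * p) := by
        rw [← mul_assoc, hpc, mul_assoc, hp, mul_smul_comm]
      have h₂ : t.map e * p * (t.map e * p) = r • p := by
        rw [mul_assoc, h₁, mul_smul_comm, ← mul_assoc, h.mul_self, one_mul]
      have h₃ : t.map e * p * p = r • (t.map e * p) := by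
        rw [mul_assoc, hp, mul_smul_comm]
      simp only [sub_mul, mul_sub, smul_mul_assoc, mul_smul_comm, hp, h₁, h₂, h₃]
      rw [smul_sub, smul_smul σ σ, hσ]
      module
    · rw [Matrix.trace_sub, Matrix.trace_smul, ← h.trace_mul p hpc, htr, smul_eq_mul,
        ← mul_assoc, hσ, one_mul, sub_self]
  rw [sub_eq_zero] at hz
  conv_rhs => rw [hz, smul_smul, hσ, one_smul]

theorem map_eq_smul_one [CharZero k] (h : IsParity R t e) {σ : k} (hσ : σ * σ = 1)
    (htr : (t.map (drinfeld R)).trace = σ * Fintype.card ι) : t.map e = σ • 1 := by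
  have := h.map_mul_eq_smul (p := 1) one_ne_zero hσ (by simp) (by simp) (by simpa using htr)
  rwa [mul_one] at this

/-- The (unnormalized) projection onto the `σ`-eigenspace of a parity form. -/
theorem eigenprojection (h : IsParity R t e) {σ : k} (hσ : σ * σ = 1) :
    t.map e * (1 + σ • t.map e) = σ • (1 + σ • t.map e) ∧
    (1 + σ • t.map e) * (1 + σ • t.map e) = (2 : k) • (1 + σ • t.map e) ∧
    (∀ f : A →ₗ[k] k, (1 + σ • t.map e) * t.map f = t.map f * (1 + σ • t.map e)) ∧
    (t.map (drinfeld R) * (1 + σ • t.map e)).trace = σ * (1 + σ • t.map e).trace := by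
  have h₁ : t.map e * (1 + σ • t.map e) = σ • (1 + σ • t.map e) := by
    rw [mul_add, mul_smul_comm, h.mul_self, smul_add, smul_smul, hσ, one_smul, mul_one, add_comm]
  have h₃ : ∀ f : A →ₗ[k] k, (1 + σ • t.map e) * t.map f = t.map f * (1 + σ • t.map e) := by
    intro f
    rw [add_mul, mul_add, one_mul, mul_one, smul_mul_assoc, mul_smul_comm, h.comm]
  refine ⟨h₁, ?_, h₃, ?_⟩
  · conv_lhs => rw [add_mul, one_mul, smul_mul_assoc, h₁, smul_smul, hσ, one_smul]
    rw [two_smul]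
  · rw [h.trace_mul _ h₃, h₁, Matrix.trace_smul, smul_eq_mul]

theorem map_unique [CharZero k] (h : IsParity R t e) (h' : IsParity R t e') :
    t.map e = t.map e' := by
  have key : ∀ σ : k, σ * σ = 1 →
      t.map e * (1 + σ • t.map e') = t.map e' * (1 + σ • t.map e') := by
    intro σ hσ
    obtain ⟨h₁, h₂, h₃, h₄⟩ := h'.eigenprojection hσ
    rw [h.map_mul_eq_smul two_ne_zero hσ h₂ h₃ h₄, h₁]
  have h₁ := key 1 (by simp)
  have h₂ := key (-1) (by simp)
  have h₃ := congrArg₂ (· + ·) h₁ h₂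
  simp only [← mul_add] at h₃
  have h₄ : (1 + (1 : k) • t.map e' + (1 + (-1 : k) • t.map e') : Matrix ι ι k) = (2 : k) • 1 := by
    rw [two_smul]; simp; abel
  rw [h₄, mul_smul_comm, mul_smul_comm, mul_one, mul_one] at h₃
  exact smul_right_injective _ two_ne_zero h₃

theorem of_fromBlocks (h : IsParity R (Matrix.fromBlocks t 0 0 s) e) :
    IsParity R t e ∧ IsParity R s e := by
  have hm : ∀ f : A →ₗ[k] k, (Matrix.fromBlocks t 0 0 s).map f =
      Matrix.fromBlocks (t.map f) 0 0 (s.map f) := by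
    intro f
    simp [Matrix.fromBlocks_map]
  have h₁ := h.mul_self
  have h₂ := h.comm
  have h₃ := h.trace_mul
  simp only [hm, Matrix.fromBlocks_multiply, Matrix.mul_zero, Matrix.zero_mul, add_zero, zero_add,
    ← Matrix.fromBlocks_one, Matrix.fromBlocks_inj, true_and] at h₁ h₂ h₃
  refine ⟨⟨h₁.1, fun f => (h₂ f).1, fun y hy => ?_⟩, ⟨h₁.2, fun f => (h₂ f).2, fun y hy => ?_⟩⟩
  · simpa [Matrix.fromBlocks_multiply, Matrix.trace, Fintype.sum_sum_type] using
      h₃ (Matrix.fromBlocks y 0 0 0) fun f => by simp [Matrix.fromBlocks_multiply, hy f]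
  · simpa [Matrix.fromBlocks_multiply, Matrix.trace, Fintype.sum_sum_type] using
      h₃ (Matrix.fromBlocks 0 0 0 y) fun f => by simp [Matrix.fromBlocks_multiply, hy f]

end IsMultiplicative.IsParity

namespace IsMultiplicative

theorem coeffSpan_le_fromBlocks_left {ι κ : Type*} {t : Matrix ι ι A} {s : Matrix κ κ A} :
    coeffSpan k t ≤ coeffSpan k (Matrix.fromBlocks t 0 0 s) := by
  refine Submodule.span_mono ?_
  rintro _ ⟨⟨i, j⟩, rfl⟩
  exact ⟨(Sum.inl i, Sum.inl j), rfl⟩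

theorem coeffSpan_le_fromBlocks_right {ι κ : Type*} {t : Matrix ι ι A} {s : Matrix κ κ A} :
    coeffSpan k s ≤ coeffSpan k (Matrix.fromBlocks t 0 0 s) := by
  refine Submodule.span_mono ?_
  rintro _ ⟨⟨i, j⟩, rfl⟩
  exact ⟨(Sum.inr i, Sum.inr j), rfl⟩

variable {ι κ : Type*} [Fintype ι] [DecidableEq ι] [Fintype κ] [DecidableEq κ]
  {t : Matrix ι ι A} {s : Matrix κ κ A} {e e' : A →ₗ[k] k}

variable [IsAlgClosed k] [CharZero k]

theorem IsParity.apply_eq (hR : IsCT (mul' k A) R) (hpi : Pseudoinvolutive k A)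
    (ht : IsMultiplicative k t) (hs : IsMultiplicative k s)
    (h : IsParity R t e) (h' : IsParity R s e') {a : A} (ha : a ∈ coeffSpan k t)
    (ha' : a ∈ coeffSpan k s) : e a = e' a := by
  obtain ⟨e₀, h₀⟩ := (ht.fromBlocks hs).exists_isParity hR hpi
  rw [eq_of_eqOn_coeffSpan (h.map_unique h₀.of_fromBlocks.1) ha,
    eq_of_eqOn_coeffSpan (h'.map_unique h₀.of_fromBlocks.2) ha']

end IsMultiplicative

open IsMultiplicative

/-- The parity forms of all finite-dimensional comodules glue to a single linear form. -/
theorem exists_isParity_forall [IsAlgClosed k] [CharZero k] (hR : IsCT (mul' k A) R)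
    (hpi : Pseudoinvolutive k A) :
    ∃ c : A →ₗ[k] k, ∀ (ι : Type) [Fintype ι] [DecidableEq ι] (t : Matrix ι ι A),
      IsMultiplicative k t → IsParity R t c := by
  choose n t ht ha using exists_isMultiplicative_mem_coeffSpan k (A := A)
  choose e he using fun a => (ht a).exists_isParity hR hpi
  have key : ∀ {ι : Type} [Fintype ι] [DecidableEq ι] {s : Matrix ι ι A} {f : A →ₗ[k] k} {a : A},
      IsMultiplicative k s → IsParity R s f → a ∈ coeffSpan k s → e a a = f a :=
    fun hs hf h => (he _).apply_eq hR hpi (ht _) hs hf (ha _) h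
  refine ⟨⟨⟨fun a => e a a, fun a b => ?_⟩, fun r a => ?_⟩, fun ι _ _ s hs => ?_⟩
  · have hab := (ht a).fromBlocks (ht b)
    obtain ⟨f, hf⟩ := hab.exists_isParity hR hpi
    have ha' := coeffSpan_le_fromBlocks_left (s := t b) (ha a)
    have hb' := coeffSpan_le_fromBlocks_right (t := t a) (ha b)
    change e (a + b) (a + b) = e a a + e b b
    rw [key hab hf ha', key hab hf hb', key hab hf (add_mem ha' hb'), map_add]
  · exact (key (ht a) (he a) (Submodule.smul_mem _ r (ha a))).trans (map_smul _ _ _)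
  · obtain ⟨f, hf⟩ := hs.exists_isParity hR hpi
    exact hf.of_map_eq (Matrix.ext fun i j => key hs hf (mem_coeffSpan s i j))

open Kronecker in
theorem IsMultiplicative.IsParity.apply_mul [CharZero k] (hR : IsCT (mul' k A) R)
    {ι κ : Type*} [Fintype ι] [DecidableEq ι] [Fintype κ] [DecidableEq κ]
    {t : Matrix ι ι A} {s : Matrix κ κ A} {c : A →ₗ[k] k}
    (ht : IsMultiplicative k t) (hs : IsMultiplicative k s)
    (h : IsParity R t c) (h' : IsParity R s c)
    (h'' : IsParity R (Matrix.of fun p q : ι × κ => t p.1 q.1 * s p.2 q.2) c)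
    (i j : ι) (p q : κ) : c (t i j * s p q) = c (t i j) * c (s p q) := by
  set r : Matrix (ι × κ) (ι × κ) A := Matrix.of fun p q : ι × κ => t p.1 q.1 * s p.2 q.2
  have hu : r.map (drinfeld R) = t.map (drinfeld R) ⊗ₖ s.map (drinfeld R) := by
    ext x y
    exact ht.drinfeld_mul hs hR _ _ _ _
  have hcl : ∀ (P : Matrix ι ι k), (∀ f : A →ₗ[k] k, P * t.map f = t.map f * P) →
      ∀ f : A →ₗ[k] k, (P ⊗ₖ (1 : Matrix κ κ k)) * r.map f = r.map f * (P ⊗ₖ 1) := by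
    intro P hP f
    ext ⟨i, p⟩ ⟨j, q⟩
    have := congrFun₂ (hP (f ∘ₗ LinearMap.mulRight k (s p q))) i j
    simpa [Matrix.mul_apply, Fintype.sum_prod_type, Matrix.one_apply, r] using this
  have hcr : ∀ (Q : Matrix κ κ k), (∀ f : A →ₗ[k] k, Q * s.map f = s.map f * Q) →
      ∀ f : A →ₗ[k] k, ((1 : Matrix ι ι k) ⊗ₖ Q) * r.map f = r.map f * (1 ⊗ₖ Q) := by
    intro Q hQ f
    ext ⟨i, p⟩ ⟨j, q⟩
    have := congrFun₂ (hQ (f ∘ₗ LinearMap.mulLeft k (t i j))) p q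
    simpa [Matrix.mul_apply, Fintype.sum_prod_type, Matrix.one_apply, r] using this
  have key : ∀ σ τ : k, σ * σ = 1 → τ * τ = 1 →
      (r.map c - t.map c ⊗ₖ s.map c) * ((1 + σ • t.map c) ⊗ₖ (1 + τ • s.map c)) = 0 := by
    intro σ τ hσ hτ
    obtain ⟨h₁, h₂, h₃, h₄⟩ := h.eigenprojection hσ
    obtain ⟨h₁', h₂', h₃', h₄'⟩ := h'.eigenprojection hτ
    generalize 1 + σ • t.map c = P at *
    generalize 1 + τ • s.map c = Q at *
    have hPQ : P ⊗ₖ Q = (P ⊗ₖ (1 : Matrix κ κ k)) * ((1 : Matrix ι ι k) ⊗ₖ Q) := by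
      rw [← Matrix.mul_kronecker_mul, mul_one, one_mul]
    rw [sub_mul, h''.map_mul_eq_smul (r := 2 * 2) (σ := σ * τ) (mul_ne_zero two_ne_zero two_ne_zero)
      (by rw [mul_mul_mul_comm, hσ, hτ, one_mul]) ?_ ?_ ?_, ← Matrix.mul_kronecker_mul, h₁, h₁']
    · simp [Matrix.smul_kronecker, Matrix.kronecker_smul, smul_smul, mul_comm τ σ]
    · rw [← Matrix.mul_kronecker_mul, h₂, h₂']
      simp [Matrix.smul_kronecker, Matrix.kronecker_smul, smul_smul]
    · intro f
      rw [hPQ, mul_assoc, hcr Q h₃', ← mul_assoc, hcl P h₃, mul_assoc]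
    · rw [hu, ← Matrix.mul_kronecker_mul, Matrix.trace_kronecker, Matrix.trace_kronecker, h₄, h₄']
      ring
  have ht2 : (2 : k) • (1 : Matrix ι ι k) =
      (1 + (1 : k) • t.map c) + (1 + (-1 : k) • t.map c) := by module
  have hs2 : (2 : k) • (1 : Matrix κ κ k) =
      (1 + (1 : k) • s.map c) + (1 + (-1 : k) • s.map c) := by module
  have h4 : (r.map c - t.map c ⊗ₖ s.map c) * (((2 : k) • 1) ⊗ₖ ((2 : k) • 1)) = 0 := by
    have h₁ := key 1 1 (by simp) (by simp)
    have h₂ := key 1 (-1) (by simp) (by simp)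
    have h₃ := key (-1) 1 (by simp) (by simp)
    have h₄ := key (-1) (-1) (by simp) (by simp)
    rw [ht2, hs2]
    generalize 1 + (1 : k) • t.map c = P₁ at *
    generalize 1 + (-1 : k) • t.map c = P₂ at *
    generalize 1 + (1 : k) • s.map c = Q₁ at *
    generalize 1 + (-1 : k) • s.map c = Q₂ at *
    rw [Matrix.add_kronecker, Matrix.kronecker_add, Matrix.kronecker_add, mul_add, mul_add,
      mul_add, h₁, h₂, h₃, h₄]
    simp
  rw [Matrix.smul_kronecker, Matrix.kronecker_smul, Matrix.one_kronecker_one, mul_smul_comm,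
    mul_smul_comm, mul_one, smul_smul, smul_eq_zero] at h4
  have h5 := h4.resolve_left (mul_ne_zero two_ne_zero two_ne_zero)
  exact congrFun₂ (sub_eq_zero.mp h5) (i, p) (j, q)

theorem IsComod.coact_eq_smul_of_trace [CharZero k] {V : Type u} [AddCommGroup V] [Module k V]
    [FiniteDimensional k V] {ρ : V →ₗ[k] V ⊗[k] A} (hρ : IsComod V ρ) {W : Submodule k V}
    (hW : IsSubcomod ρ W) {c : A →ₗ[k] k} (hc : ∀ (n : ℕ) (t : Matrix (Fin n) (Fin n) A),
      IsMultiplicative k t → IsParity R t c) {σ : k} (hσ : σ * σ = 1)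
    (h : ∀ x ∈ W, coact ρ (drinfeld R) x ∈ W)
    (htr : LinearMap.trace k W ((coact ρ (drinfeld R)).restrict h) = σ * Module.finrank k W)
    {x : V} (hx : x ∈ W) : coact ρ c x = σ • x := by
  let b := Module.finBasis k W
  obtain ⟨t, ht, hb⟩ := hW.exists_isMultiplicative hρ b
  have hcoact : ∀ (f : A →ₗ[k] k) j, coact ρ f (b j) = ∑ i, f (t i j) • (b i : V) := by
    intro f j
    simp [coact, hb]
  have hu : LinearMap.toMatrix b b ((coact ρ (drinfeld R)).restrict h) = t.map (drinfeld R) := by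
    ext i j
    have : (coact ρ (drinfeld R)).restrict h (b j) = ∑ i, drinfeld R (t i j) • b i := by
      apply Subtype.ext
      simp [hcoact]
    rw [LinearMap.toMatrix_apply, this]
    simp [map_sum, Finsupp.single_apply]
  rw [LinearMap.trace_eq_matrix_trace k b, hu] at htr
  have ht' := (hc _ t ht).map_eq_smul_one hσ (by simpa using htr)
  have hbc : ∀ j, coact ρ c (b j) = σ • (b j : V) := by
    intro j
    have : ∀ i, c (t i j) = (σ • (1 : Matrix _ _ k)) i j := fun i => congrFun₂ ht' i j
    simp [hcoact, this, Matrix.one_apply]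
  have := b.ext (f₁ := coact ρ c ∘ₗ W.subtype) (f₂ := σ • W.subtype) hbc
  exact LinearMap.congr_fun this ⟨x, hx⟩

end

section

/-- For a pseudoinvolutive cotriangular Hopf algebra `(A, R)` with Drinfeld
element `u`, there is a central grouplike `c ∈ A*` with `c ∗ c = ε` such that, for every
finite-dimensional right `A`-comodule `V` with decomposition `V = V₊ ⊕ V₋` into a positive and
a negative subcomodule, `c|_V` is the identity on `V₊` and minus the identity on `V₋`. -/
theorem statement4 {k A : Type u} [Field k] [IsAlgClosed k] [CharZero k]
    [Ring A] [HopfAlgebra k A]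
    (R : A ⊗[k] A →ₗ[k] k) (hR : IsCT (mul' k A) R)
    (hpi : Pseudoinvolutive k A) :
    ∃ c : A →ₗ[k] k, IsGrouplikeForm c ∧ IsConvCentral c ∧
      conv1 c c = Coalgebra.counit ∧
      ∀ (V : Type u) [AddCommGroup V] [Module k V] [FiniteDimensional k V]
        (ρ : V →ₗ[k] V ⊗[k] A), IsComod V ρ →
        ∀ Vp Vn : Submodule k V, IsSubcomod ρ Vp → IsSubcomod ρ Vn → IsCompl Vp Vn →
          SubPos ρ (drinfeld R) Vp → SubNeg ρ (drinfeld R) Vn →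
            (∀ x ∈ Vp, coact ρ c x = x) ∧ (∀ x ∈ Vn, coact ρ c x = -x) := by
  obtain ⟨c, hc⟩ := exists_isParity_forall hR hpi
  refine ⟨c, ⟨?_, ?_⟩, fun f => linearForm_ext fun n t ht => ?_,
    linearForm_ext fun n t ht => ?_, ?_⟩
  · have := (hc Unit 1 isMultiplicative_one).map_eq_smul_one (σ := 1) (one_mul 1)
      (by simp [Matrix.trace, drinfeld_one hR.toIsCQT])
    simpa using congrFun₂ this () ()
  · intro a b
    obtain ⟨n, t, ht, ha⟩ := exists_isMultiplicative_mem_coeffSpan k a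
    obtain ⟨m, s, hs, hb⟩ := exists_isMultiplicative_mem_coeffSpan k b
    refine LinearMap.eqOn_span (s := Set.range fun p : Fin n × Fin n => t p.1 p.2)
      (f := c ∘ₗ LinearMap.mulRight k b) (g := LinearMap.mulRight k (c b) ∘ₗ c) ?_ ha
    rintro _ ⟨⟨i, j⟩, rfl⟩
    refine LinearMap.eqOn_span (s := Set.range fun p : Fin m × Fin m => s p.1 p.2)
      (f := c ∘ₗ LinearMap.mulLeft k (t i j)) (g := LinearMap.mulLeft k (c (t i j)) ∘ₗ c) ?_ hb
    rintro _ ⟨⟨p, q⟩, rfl⟩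
    exact IsMultiplicative.IsParity.apply_mul hR ht hs (hc _ t ht) (hc _ s hs)
      (hc _ _ (ht.kronecker hs)) i j p q
  · rw [ht.map_conv1, ht.map_conv1, (hc _ t ht).comm]
  · rw [ht.map_conv1, (hc _ t ht).mul_self, ht.map_counit]
  · rintro V _ _ _ ρ hρ Vp Vn hVp hVn - ⟨hp, htp⟩ ⟨hn, htn⟩
    have hc' := fun n (t : Matrix (Fin n) (Fin n) A) => hc (Fin n) t
    refine ⟨fun x hx => ?_, fun x hx => ?_⟩
    · simpa using hρ.coact_eq_smul_of_trace hVp hc' (one_mul 1) hp (by simpa using htp) hx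
    · simpa using hρ.coact_eq_smul_of_trace hVn hc' (σ := -1) (by simp) hn (by simpa using htn) hx

end

end
end

section
/- Let (A,R) be a cotriangular Hopf algebra over k with Drinfeld element u, and let c : A → k be an algebra homomorphism (a grouplike element of A*) which is central in the convolution algebra A* and satisfies c∗c = ε. Define R_c : A⊗A → k by R_c(a⊗b) = (1/2)(ε(a)ε(b) + ε(a)c(b) + c(a)ε(b) − c(a)c(b)). Then R∗R_c (convolution product in (A⊗A)*) is again a cotriangular structure on A, i.e. (A, R∗R_c) satisfies all the coquasitriangularity axioms and the triangularity condition, and its Drinfeld element equals u∗c. -/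
open TensorProduct LinearMap

noncomputable section


universe u
variable {k A : Type u} [Field k] [Ring A] [HopfAlgebra k A]

section

/-- Translation by a linear form: `a ↦ Σ a₁ f(a₂)`. -/
def formTranslate (f : A →ₗ[k] k) : A →ₗ[k] A :=
  (TensorProduct.rid k A).toLinearMap ∘ₗ map LinearMap.id f ∘ₗ Coalgebra.comul

lemma comp_formTranslate (f g : A →ₗ[k] k) : f ∘ₗ formTranslate g = conv1 f g := by
  have h : f ∘ₗ (TensorProduct.rid k A).toLinearMap ∘ₗ map LinearMap.id g =
      mul' k k ∘ₗ map f g := by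
    ext x y
    simp [mul_comm]
  rw [conv1, ← comp_assoc, ← h]
  rfl

lemma formTranslate_counit : formTranslate (Coalgebra.counit : A →ₗ[k] k) = LinearMap.id := by
  ext a
  have := Coalgebra.lTensor_counit_comul (R := k) a
  rw [LinearMap.lTensor] at this
  simp [formTranslate, this]

lemma formTranslate_one {c : A →ₗ[k] k} (h1 : c 1 = 1) : formTranslate c 1 = 1 := by
  simp [formTranslate, Algebra.TensorProduct.one_def, h1]

lemma formTranslate_mul {c : A →ₗ[k] k} (hmul : ∀ a b, c (a * b) = c a * c b) (a b : A) :
    formTranslate c (a * b) = formTranslate c a * formTranslate c b := by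
  have key : ∀ x y : A ⊗[k] A,
      TensorProduct.rid k A (map LinearMap.id c (x * y)) =
        TensorProduct.rid k A (map LinearMap.id c x) *
          TensorProduct.rid k A (map LinearMap.id c y) := by
    intro x y
    induction x with
    | zero => simp
    | add x₁ x₂ h₁ h₂ => simp only [add_mul, map_add, h₁, h₂]
    | tmul p q =>
      induction y with
      | zero => simp
      | add x₁ x₂ h₁ h₂ => simp only [mul_add, map_add, h₁, h₂]
      | tmul r s => simp [hmul, smul_smul, mul_comm]
  simpa [formTranslate] using key (Coalgebra.comul a) (Coalgebra.comul b)

lemma comul_comp_formTranslate (f : A →ₗ[k] k) :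
    Coalgebra.comul ∘ₗ formTranslate f =
      map LinearMap.id (formTranslate f) ∘ₗ (Coalgebra.comul : A →ₗ[k] A ⊗[k] A) := by
  have e₁ : (Coalgebra.comul : A →ₗ[k] A ⊗[k] A) ∘ₗ (TensorProduct.rid k A).toLinearMap ∘ₗ
      map LinearMap.id f =
      map LinearMap.id ((TensorProduct.rid k A).toLinearMap ∘ₗ map LinearMap.id f) ∘ₗ
        (TensorProduct.assoc k A A A).toLinearMap ∘ₗ Coalgebra.comul.rTensor A := by
    ext x y
    simp only [TensorProduct.AlgebraTensorModule.curry_apply, restrictScalars_self, curry_apply,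
      LinearMap.comp_apply, LinearEquiv.coe_coe, map_tmul, rid_tmul, id_apply, rTensor_tmul,
      map_smul]
    induction (Coalgebra.comul x : A ⊗[k] A) with
    | zero => simp
    | add p q hp hq => simp only [smul_add, add_tmul, map_add, hp, hq]
    | tmul p q => simp
  have e₂ : (map LinearMap.id (formTranslate f) : A ⊗[k] A →ₗ[k] A ⊗[k] A) =
      map LinearMap.id ((TensorProduct.rid k A).toLinearMap ∘ₗ map LinearMap.id f) ∘ₗ
        Coalgebra.comul.lTensor A := by
    ext x y
    simp [formTranslate]
  rw [e₂, comp_assoc, ← Coalgebra.coassoc]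
  conv_lhs => rw [formTranslate]
  simp only [← comp_assoc] at e₁ ⊢
  rw [e₁]

lemma formTranslate_comp_formTranslate (f g : A →ₗ[k] k) :
    formTranslate f ∘ₗ formTranslate g = formTranslate (conv1 f g) := by
  have h : (TensorProduct.rid k A).toLinearMap ∘ₗ map LinearMap.id f ∘ₗ
      map LinearMap.id (formTranslate g) =
      (TensorProduct.rid k A).toLinearMap ∘ₗ map LinearMap.id (conv1 f g) := by
    rw [← map_comp, comp_formTranslate, LinearMap.comp_id]
  conv_lhs => rw [formTranslate]
  rw [comp_assoc, comp_assoc, comul_comp_formTranslate]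
  simp only [← comp_assoc] at h ⊢
  rw [h]
  rfl

lemma tensorMap_sub_left {M N P Q : Type*} [AddCommGroup M] [AddCommGroup N] [AddCommGroup P]
    [AddCommGroup Q] [Module k M] [Module k N] [Module k P] [Module k Q]
    (f g : M →ₗ[k] P) (h : N →ₗ[k] Q) : map (f - g) h = map f h - map g h :=
  LinearMap.map_sub₂ (TensorProduct.mapBilinear (.id k) M N P Q) f g h

lemma tensorMap_sub_right {M N P Q : Type*} [AddCommGroup M] [AddCommGroup N] [AddCommGroup P]
    [AddCommGroup Q] [Module k M] [Module k N] [Module k P] [Module k Q]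
    (f : M →ₗ[k] P) (g h : N →ₗ[k] Q) : map f (g - h) = map f g - map f h :=
  _root_.map_sub (TensorProduct.mapBilinear (.id k) M N P Q f) g h

lemma eq_of_forall_form {V : Type*} [AddCommGroup V] [Module k V] {x y : V}
    (h : ∀ f : V →ₗ[k] k, f x = f y) : x = y := by
  rw [← sub_eq_zero, ← Module.forall_dual_apply_eq_zero_iff k]
  intro f
  rw [map_sub, h f, sub_self]

lemma formTranslate_eq_of_isConvCentral {c : A →ₗ[k] k} (hc : IsConvCentral c) :
    formTranslate c = (TensorProduct.lid k A).toLinearMap ∘ₗ map c LinearMap.id ∘ₗ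
      Coalgebra.comul := by
  ext a
  refine eq_of_forall_form (k := k) fun f => ?_
  have h : f ∘ₗ (TensorProduct.lid k A).toLinearMap ∘ₗ map c LinearMap.id =
      mul' k k ∘ₗ map c f := by
    ext x y
    simp
  have h₂ : f (formTranslate c a) = conv1 f c a := by rw [← comp_formTranslate]; rfl
  rw [h₂, ← hc f]
  exact (LinearMap.congr_fun h (Coalgebra.comul a)).symm

lemma comul_comp_formTranslate_of_isConvCentral {c : A →ₗ[k] k} (hc : IsConvCentral c) :
    Coalgebra.comul ∘ₗ formTranslate c =
      map (formTranslate c) LinearMap.id ∘ₗ (Coalgebra.comul : A →ₗ[k] A ⊗[k] A) := by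
  have e₁ : (Coalgebra.comul : A →ₗ[k] A ⊗[k] A) ∘ₗ (TensorProduct.lid k A).toLinearMap ∘ₗ
      map c LinearMap.id =
      map ((TensorProduct.lid k A).toLinearMap ∘ₗ map c LinearMap.id) LinearMap.id ∘ₗ
        (TensorProduct.assoc k A A A).symm.toLinearMap ∘ₗ Coalgebra.comul.lTensor A := by
    ext x y
    simp only [TensorProduct.AlgebraTensorModule.curry_apply, restrictScalars_self, curry_apply,
      LinearMap.comp_apply, LinearEquiv.coe_coe, map_tmul, lid_tmul, id_apply, lTensor_tmul,
      map_smul]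
    induction (Coalgebra.comul y : A ⊗[k] A) with
    | zero => simp
    | add p q hp hq => simp only [smul_add, tmul_add, map_add, hp, hq]
    | tmul p q => simp [smul_tmul']
  have e₂ : (map (formTranslate c) LinearMap.id : A ⊗[k] A →ₗ[k] A ⊗[k] A) =
      map ((TensorProduct.lid k A).toLinearMap ∘ₗ map c LinearMap.id) LinearMap.id ∘ₗ
        Coalgebra.comul.rTensor A := by
    rw [formTranslate_eq_of_isConvCentral hc]
    ext x y
    simp
  rw [e₂, comp_assoc, ← Coalgebra.coassoc_symm, formTranslate_eq_of_isConvCentral hc]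
  simp only [← comp_assoc] at e₁ ⊢
  rw [e₁]

lemma antipode_comp_formTranslate {c : A →ₗ[k] k} (hgl : IsGrouplikeForm c) (hc : IsConvCentral c)
    (hc2 : conv1 c c = Coalgebra.counit) :
    HopfAlgebra.antipode k ∘ₗ formTranslate c = formTranslate c ∘ₗ HopfAlgebra.antipode k := by
  have hTT : formTranslate c ∘ₗ formTranslate c = LinearMap.id := by
    rw [formTranslate_comp_formTranslate, hc2, formTranslate_counit]
  have hmul : mul' k A ∘ₗ map (formTranslate c) (formTranslate c) = formTranslate c ∘ₗ mul' k A := by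
    ext x y
    simp [formTranslate_mul hgl.2]
  have hinv : mul' k A ∘ₗ
      map (formTranslate c ∘ₗ HopfAlgebra.antipode k ∘ₗ formTranslate c) LinearMap.id ∘ₗ
      Coalgebra.comul = Algebra.linearMap k A ∘ₗ Coalgebra.counit := by
    have e : map (formTranslate c ∘ₗ HopfAlgebra.antipode k ∘ₗ formTranslate c)
        (LinearMap.id : A →ₗ[k] A) =
        map (formTranslate c ∘ₗ HopfAlgebra.antipode k) LinearMap.id ∘ₗ
          map (formTranslate c) LinearMap.id := by
      rw [← map_comp]; rfl
    have e' : map (formTranslate c ∘ₗ HopfAlgebra.antipode k) LinearMap.id ∘ₗ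
        map LinearMap.id (formTranslate c) =
        map (formTranslate c) (formTranslate c) ∘ₗ (HopfAlgebra.antipode k).rTensor A := by
      rw [LinearMap.rTensor, ← map_comp, ← map_comp]; rfl
    rw [e, comp_assoc, ← comul_comp_formTranslate_of_isConvCentral hc, comul_comp_formTranslate,
      ← comp_assoc _ _ (map _ _), e', comp_assoc, ← comp_assoc, hmul, comp_assoc,
      HopfAlgebra.mul_antipode_rTensor_comul]
    ext a
    simp [Algebra.algebraMap_eq_smul_one, formTranslate_one hgl.1]
  have h : WithConv.toConv (formTranslate c ∘ₗ HopfAlgebra.antipode k ∘ₗ formTranslate c) =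
      WithConv.toConv (HopfAlgebra.antipode k (A := A)) := by
    refine left_inv_eq_right_inv (a := WithConv.toConv (LinearMap.id : A →ₗ[k] A)) ?_ ?_
    · exact congrArg WithConv.toConv hinv
    · exact congrArg WithConv.toConv (HopfAlgebra.mul_antipode_lTensor_comul (R := k) (A := A))
  have hTST := WithConv.toConv_injective h
  calc HopfAlgebra.antipode k ∘ₗ formTranslate c
      = (formTranslate c ∘ₗ formTranslate c) ∘ₗ HopfAlgebra.antipode k ∘ₗ formTranslate c := by
        rw [hTT, LinearMap.id_comp]
    _ = formTranslate c ∘ₗ HopfAlgebra.antipode k := by rw [comp_assoc, hTST]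

/-- The operator `½ (1 ⊗ 1 + 1 ⊗ T + T ⊗ 1 - T ⊗ T)` on `A ⊗ A`. -/
def halfTwist (T : A →ₗ[k] A) : A ⊗[k] A →ₗ[k] A ⊗[k] A :=
  (2⁻¹ : k) • (LinearMap.id + map LinearMap.id T + map T LinearMap.id - map T T)

lemma halfTwist_tmul (T : A →ₗ[k] A) (a b : A) :
    halfTwist T (a ⊗ₜ b) =
      (2⁻¹ : k) • (a ⊗ₜ b + a ⊗ₜ T b + T a ⊗ₜ b - T a ⊗ₜ T b) := by
  simp [halfTwist]

lemma conv2_pairForm (R : A ⊗[k] A →ₗ[k] k) (f g : A →ₗ[k] k) :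
    conv2 R (pairForm f g) = R ∘ₗ map (formTranslate f) (formTranslate g) := by
  have h : mul' k k ∘ₗ map R (pairForm f g) ∘ₗ
      (tensorTensorTensorComm k A A A A).toLinearMap =
      R ∘ₗ map ((TensorProduct.rid k A).toLinearMap ∘ₗ map LinearMap.id f)
        ((TensorProduct.rid k A).toLinearMap ∘ₗ map LinearMap.id g) := by
    ext a b x y
    simp [pairForm, ← smul_tmul', tmul_smul]
    ring
  ext a b
  have := LinearMap.congr_fun h (Coalgebra.comul a ⊗ₜ Coalgebra.comul b)
  simpa [conv2, formTranslate, TensorProduct.comul_tmul,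
    AlgebraTensorModule.tensorTensorTensorComm_eq] using this

lemma conv2_Rc (R : A ⊗[k] A →ₗ[k] k) (c : A →ₗ[k] k) :
    conv2 R (Rc c) = R ∘ₗ halfTwist (formTranslate c) := by
  have h : conv2 R (Rc c) = (2⁻¹ : k) • (conv2 R (pairForm Coalgebra.counit Coalgebra.counit) +
      conv2 R (pairForm Coalgebra.counit c) + conv2 R (pairForm c Coalgebra.counit) -
      conv2 R (pairForm c c)) := by
    simp only [conv2, Rc, map_smul_right, map_add_right, tensorMap_sub_right]
    ext
    simp
  simp only [h, conv2_pairForm, formTranslate_counit, halfTwist, map_id]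
  ext
  simp

lemma halfTwist_comp_halfTwist [CharZero k] {T : A →ₗ[k] A} (hT : T ∘ₗ T = LinearMap.id) :
    halfTwist T ∘ₗ halfTwist T = LinearMap.id := by
  have hT' (a : A) : T (T a) = a := LinearMap.congr_fun hT a
  ext a b
  simp [halfTwist_tmul, hT']
  module

lemma comul_comp_map {S T : A →ₗ[k] A}
    {S₁ S₂ T₁ T₂ : A →ₗ[k] A}
    (hS : Coalgebra.comul ∘ₗ S = map S₁ S₂ ∘ₗ (Coalgebra.comul : A →ₗ[k] A ⊗[k] A))
    (hT : Coalgebra.comul ∘ₗ T = map T₁ T₂ ∘ₗ (Coalgebra.comul : A →ₗ[k] A ⊗[k] A)) :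
    (Coalgebra.comul : A ⊗[k] A →ₗ[k] (A ⊗[k] A) ⊗[k] (A ⊗[k] A)) ∘ₗ map S T =
      map (map S₁ T₁) (map S₂ T₂) ∘ₗ Coalgebra.comul := by
  have h : (tensorTensorTensorComm k A A A A).toLinearMap ∘ₗ map (map S₁ S₂) (map T₁ T₂) =
      map (map S₁ T₁) (map S₂ T₂) ∘ₗ (tensorTensorTensorComm k A A A A).toLinearMap := by
    ext
    simp
  ext a b
  have hSa := LinearMap.congr_fun hS a
  have hTb := LinearMap.congr_fun hT b
  have := LinearMap.congr_fun h (Coalgebra.comul a ⊗ₜ Coalgebra.comul b)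
  simp only [LinearMap.comp_apply] at hSa hTb
  simpa [TensorProduct.comul_tmul, AlgebraTensorModule.tensorTensorTensorComm_eq, hSa, hTb] using this

lemma comul_comp_halfTwist_right {T : A →ₗ[k] A}
    (hT : Coalgebra.comul ∘ₗ T =
      map LinearMap.id T ∘ₗ (Coalgebra.comul : A →ₗ[k] A ⊗[k] A)) :
    (Coalgebra.comul : A ⊗[k] A →ₗ[k] (A ⊗[k] A) ⊗[k] (A ⊗[k] A)) ∘ₗ halfTwist T =
      map LinearMap.id (halfTwist T) ∘ₗ Coalgebra.comul := by
  have hid : Coalgebra.comul ∘ₗ LinearMap.id =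
      map LinearMap.id LinearMap.id ∘ₗ (Coalgebra.comul : A →ₗ[k] A ⊗[k] A) := by
    rw [map_id]; rfl
  simp only [halfTwist, comp_smul, comp_add, comp_sub, map_smul_right, map_add_right,
    tensorMap_sub_right, smul_comp, add_comp, sub_comp, comul_comp_map hid hT, comul_comp_map hT hid,
    comul_comp_map hT hT, map_id, LinearMap.comp_id, LinearMap.id_comp]

lemma comul_comp_halfTwist_left {T : A →ₗ[k] A}
    (hT : Coalgebra.comul ∘ₗ T =
      map T LinearMap.id ∘ₗ (Coalgebra.comul : A →ₗ[k] A ⊗[k] A)) :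
    (Coalgebra.comul : A ⊗[k] A →ₗ[k] (A ⊗[k] A) ⊗[k] (A ⊗[k] A)) ∘ₗ halfTwist T =
      map (halfTwist T) LinearMap.id ∘ₗ Coalgebra.comul := by
  have hid : Coalgebra.comul ∘ₗ LinearMap.id =
      map LinearMap.id LinearMap.id ∘ₗ (Coalgebra.comul : A →ₗ[k] A ⊗[k] A) := by
    rw [map_id]; rfl
  simp only [halfTwist, comp_smul, comp_add, comp_sub, map_smul_left, map_add_left,
    tensorMap_sub_left, smul_comp, add_comp, sub_comp, comul_comp_map hid hT, comul_comp_map hT hid,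
    comul_comp_map hT hT, map_id, LinearMap.comp_id, LinearMap.id_comp]

lemma halfTwist_comp_comm (T : A →ₗ[k] A) :
    halfTwist T ∘ₗ (TensorProduct.comm k A A).toLinearMap =
      (TensorProduct.comm k A A).toLinearMap ∘ₗ halfTwist T := by
  ext a b
  simp [halfTwist_tmul]
  module

/-- A linear map `T` which can be moved across either leg of the comultiplication. -/
structure IsBicentral (T : A →ₗ[k] A) : Prop where
  comul_right : Coalgebra.comul ∘ₗ T =
    map LinearMap.id T ∘ₗ (Coalgebra.comul : A →ₗ[k] A ⊗[k] A)
  comul_left : Coalgebra.comul ∘ₗ T =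
    map T LinearMap.id ∘ₗ (Coalgebra.comul : A →ₗ[k] A ⊗[k] A)

lemma IsBicentral.conv1_comp_left {T : A →ₗ[k] A} (hT : IsBicentral T) (f g : A →ₗ[k] k) :
    conv1 (f ∘ₗ T) g = conv1 f g ∘ₗ T := by
  rw [conv1, conv1, comp_assoc, comp_assoc, hT.comul_left, ← comp_assoc _ _ (map f g), ← map_comp,
    LinearMap.comp_id]

lemma IsBicentral.conv1_comp_right {T : A →ₗ[k] A} (hT : IsBicentral T) (f g : A →ₗ[k] k) :
    conv1 f (g ∘ₗ T) = conv1 f g ∘ₗ T := by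
  rw [conv1, conv1, comp_assoc, comp_assoc, hT.comul_right, ← comp_assoc _ _ (map f g), ← map_comp,
    LinearMap.comp_id]

lemma conv1_smul_add_sub_left (r : k) (f₁ f₂ f₃ f₄ g : A →ₗ[k] k) :
    conv1 (r • (f₁ + f₂ + f₃ - f₄)) g =
      r • (conv1 f₁ g + conv1 f₂ g + conv1 f₃ g - conv1 f₄ g) := by
  simp only [conv1, map_smul_left, map_add_left, tensorMap_sub_left]
  ext
  simp

lemma conv1_smul_add_sub_right (r : k) (f₁ f₂ f₃ f₄ g : A →ₗ[k] k) :
    conv1 g (r • (f₁ + f₂ + f₃ - f₄)) =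
      r • (conv1 g f₁ + conv1 g f₂ + conv1 g f₃ - conv1 g f₄) := by
  simp only [conv1, map_smul_right, map_add_right, tensorMap_sub_right]
  ext
  simp

lemma mul_left_iff {R : A ⊗[k] A →ₗ[k] k} :
    R ∘ₗ map (mul' k A) LinearMap.id =
      mul' k k ∘ₗ map R R ∘ₗ (tensorTensorTensorComm k A A A A).toLinearMap ∘ₗ
        map LinearMap.id Coalgebra.comul ↔
    ∀ a b, curry R (a * b) = conv1 (curry R a) (curry R b) := by
  have key (a b : A) : mul' k k ∘ₗ map (curry R a) (curry R b) =
      mul' k k ∘ₗ map R R ∘ₗ (tensorTensorTensorComm k A A A A).toLinearMap ∘ₗ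
        TensorProduct.mk k (A ⊗[k] A) (A ⊗[k] A) (a ⊗ₜ b) := by
    ext; simp
  have key' (a b x : A) := LinearMap.congr_fun (key a b) (Coalgebra.comul x)
  simp only [LinearMap.comp_apply] at key'
  constructor
  · intro h a b
    ext x
    have := LinearMap.congr_fun h ((a ⊗ₜ b) ⊗ₜ x)
    simp only [conv1, LinearMap.comp_apply, key']
    simpa using this
  · intro h
    ext a b x
    have := LinearMap.congr_fun (h a b) x
    simp only [conv1, LinearMap.comp_apply, key'] at this
    simpa using this

lemma mul_right_iff {R : A ⊗[k] A →ₗ[k] k} :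
    R ∘ₗ map LinearMap.id (mul' k A) =
      mul' k k ∘ₗ map R R ∘ₗ (tensorTensorTensorComm k A A A A).toLinearMap ∘ₗ
        map LinearMap.id (TensorProduct.comm k A A).toLinearMap ∘ₗ
        map Coalgebra.comul LinearMap.id ↔
    ∀ b c, (curry R).flip (b * c) = conv1 ((curry R).flip c) ((curry R).flip b) := by
  have key (b c : A) : mul' k k ∘ₗ map ((curry R).flip c) ((curry R).flip b) =
      mul' k k ∘ₗ map R R ∘ₗ (tensorTensorTensorComm k A A A A).toLinearMap ∘ₗ
        (TensorProduct.mk k (A ⊗[k] A) (A ⊗[k] A)).flip (c ⊗ₜ b) := by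
    ext; simp
  have key' (b c x : A) := LinearMap.congr_fun (key b c) (Coalgebra.comul x)
  simp only [LinearMap.comp_apply] at key'
  constructor
  · intro h b c
    ext x
    have := LinearMap.congr_fun h (x ⊗ₜ (b ⊗ₜ c))
    simp only [conv1, LinearMap.comp_apply, key']
    simpa using this
  · intro h
    ext x b c
    have := LinearMap.congr_fun (h b c) x
    simp only [conv1, LinearMap.comp_apply, key'] at this
    simpa using this

lemma curry_comp_halfTwist (R : A ⊗[k] A →ₗ[k] k) (T : A →ₗ[k] A) (a : A) :
    curry (R ∘ₗ halfTwist T) a =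
      (2⁻¹ : k) • (curry R a + curry R a ∘ₗ T + curry R (T a) - curry R (T a) ∘ₗ T) := by
  ext b
  simp [halfTwist_tmul]

lemma flip_curry_comp_halfTwist (R : A ⊗[k] A →ₗ[k] k) (T : A →ₗ[k] A) (b : A) :
    (curry (R ∘ₗ halfTwist T)).flip b =
      (2⁻¹ : k) • ((curry R).flip b + (curry R).flip b ∘ₗ T + (curry R).flip (T b) -
        (curry R).flip (T b) ∘ₗ T) := by
  ext a
  simp [halfTwist_tmul, -mul_eq_mul_left_iff]
  ring

/-- If `f = R(a ⊗ -)`, `g = R(b ⊗ -)`, and the primed forms are `R(T a ⊗ -)`, `R(T b ⊗ -)`, this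
is the multiplicativity of `R ∘ halfTwist T` in the first argument. -/
lemma IsBicentral.conv1_halfTwist [CharZero k] {T : A →ₗ[k] A} (hT : IsBicentral T)
    (hTT : T ∘ₗ T = LinearMap.id) (f f' g g' : A →ₗ[k] k) :
    conv1 ((2⁻¹ : k) • (f + f ∘ₗ T + f' - f' ∘ₗ T)) ((2⁻¹ : k) • (g + g ∘ₗ T + g' - g' ∘ₗ T)) =
      (2⁻¹ : k) • (conv1 f g + conv1 f g ∘ₗ T + conv1 f' g' - conv1 f' g' ∘ₗ T) := by
  simp only [conv1_smul_add_sub_left, conv1_smul_add_sub_right, hT.conv1_comp_left,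
    hT.conv1_comp_right, add_comp, sub_comp, smul_comp, comp_assoc, hTT, LinearMap.comp_id]
  module

lemma conv2_comp_halfTwist [CharZero k] {T : A →ₗ[k] A} (hT : IsBicentral T)
    (hTT : T ∘ₗ T = LinearMap.id) (F G : A ⊗[k] A →ₗ[k] k) :
    conv2 (F ∘ₗ halfTwist T) (G ∘ₗ halfTwist T) = conv2 F G := by
  have h : map (F ∘ₗ halfTwist T) (G ∘ₗ halfTwist T) =
      map F G ∘ₗ map (halfTwist T) LinearMap.id ∘ₗ map LinearMap.id (halfTwist T) := by
    simp only [← map_comp, LinearMap.comp_id, LinearMap.id_comp]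
  rw [conv2, conv2, h]
  simp only [comp_assoc]
  rw [← comul_comp_halfTwist_right hT.comul_right, ← comp_assoc _ _ (map (halfTwist T) _),
    ← comul_comp_halfTwist_left hT.comul_left, comp_assoc, halfTwist_comp_halfTwist hTT,
    LinearMap.comp_id]

lemma isBicentral_formTranslate {c : A →ₗ[k] k} (hc : IsConvCentral c) :
    IsBicentral (formTranslate c) :=
  ⟨comul_comp_formTranslate c, comul_comp_formTranslate_of_isConvCentral hc⟩

lemma IsBicentral.halfTwist_comp_comul [CharZero k] {T : A →ₗ[k] A} (hT : IsBicentral T)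
    (hTT : T ∘ₗ T = LinearMap.id) :
    halfTwist T ∘ₗ (Coalgebra.comul : A →ₗ[k] A ⊗[k] A) = Coalgebra.comul ∘ₗ T := by
  have h : map T T ∘ₗ (Coalgebra.comul : A →ₗ[k] A ⊗[k] A) = Coalgebra.comul := by
    have e : map T T = map T LinearMap.id ∘ₗ map (LinearMap.id : A →ₗ[k] A) T := by
      simp only [← map_comp, LinearMap.comp_id, LinearMap.id_comp]
    rw [e, comp_assoc, ← hT.comul_right, ← comp_assoc, ← hT.comul_left, comp_assoc, hTT,
      LinearMap.comp_id]
  simp only [halfTwist, smul_comp, add_comp, sub_comp, h, ← hT.comul_left, ← hT.comul_right,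
    LinearMap.id_comp]
  module

lemma halfTwist_comp_map_id {S T : A →ₗ[k] A} (h : S ∘ₗ T = T ∘ₗ S) :
    halfTwist T ∘ₗ map LinearMap.id S = map LinearMap.id S ∘ₗ halfTwist T := by
  have h' (a : A) : S (T a) = T (S a) := LinearMap.congr_fun h a
  ext a b
  simp [halfTwist_tmul, h']

theorem IsCT.comp_halfTwist [CharZero k] {R : A ⊗[k] A →ₗ[k] k} (hR : IsCT (mul' k A) R)
    {T : A →ₗ[k] A} (hT : IsBicentral T) (hTT : T ∘ₗ T = LinearMap.id) (hone : T 1 = 1)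
    (hmul : ∀ a b, T (a * b) = T a * T b) : IsCT (mul' k A) (R ∘ₗ halfTwist T) := by
  have htr : conv2 (R ∘ₗ halfTwist T)
      ((R ∘ₗ halfTwist T) ∘ₗ (TensorProduct.comm k A A).toLinearMap) = eps2 := by
    rw [comp_assoc _ _ R, halfTwist_comp_comm, ← comp_assoc _ _ R, conv2_comp_halfTwist hT hTT,
      hR.tri_right]
  have htl : conv2 ((R ∘ₗ halfTwist T) ∘ₗ (TensorProduct.comm k A A).toLinearMap)
      (R ∘ₗ halfTwist T) = eps2 := by
    rw [comp_assoc _ _ R, halfTwist_comp_comm, ← comp_assoc _ _ R, conv2_comp_halfTwist hT hTT,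
      hR.tri_left]
  refine ⟨⟨⟨_, htr, htl⟩, mul_left_iff.2 fun a b => ?_, mul_right_iff.2 fun b c => ?_,
    fun a => ?_, fun a => ?_, ?_⟩, htr, htl⟩
  · simp only [curry_comp_halfTwist, hT.conv1_halfTwist hTT, hmul, mul_left_iff.1 hR.mul_left]
  · simp only [flip_curry_comp_halfTwist, hT.conv1_halfTwist hTT, hmul,
      mul_right_iff.1 hR.mul_right]
  · simp only [LinearMap.comp_apply, halfTwist_tmul, hone, map_smul, map_add, map_sub,
      hR.unit_right, smul_eq_mul]
    ring
  · simp only [LinearMap.comp_apply, halfTwist_tmul, hone, map_smul, map_add, map_sub,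
      hR.unit_left, smul_eq_mul]
    ring
  · have h := congrArg (fun F => F ∘ₗ halfTwist T) hR.comm_rel
    simp only [comp_assoc] at h
    have e₁ : map (mul' k A ∘ₗ (TensorProduct.comm k A A).toLinearMap) (R ∘ₗ halfTwist T) =
        map (mul' k A ∘ₗ (TensorProduct.comm k A A).toLinearMap) R ∘ₗ
          map LinearMap.id (halfTwist T) := by
      rw [← map_comp, LinearMap.comp_id]
    have e₂ : map (R ∘ₗ halfTwist T) (mul' k A) =
        map R (mul' k A) ∘ₗ map (halfTwist T) LinearMap.id := by
      rw [← map_comp, LinearMap.comp_id]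
    rw [e₁, e₂, comp_assoc, comp_assoc, ← comul_comp_halfTwist_right hT.comul_right,
      ← comul_comp_halfTwist_left hT.comul_left]
    exact h

theorem drinfeld_comp_halfTwist [CharZero k] (R : A ⊗[k] A →ₗ[k] k) {T : A →ₗ[k] A}
    (hT : IsBicentral T) (hTT : T ∘ₗ T = LinearMap.id)
    (hS : HopfAlgebra.antipode k ∘ₗ T = T ∘ₗ HopfAlgebra.antipode k) :
    drinfeld (R ∘ₗ halfTwist T) = drinfeld R ∘ₗ T := by
  simp only [drinfeld, comp_assoc]
  rw [← comp_assoc _ _ (halfTwist T), halfTwist_comp_map_id hS, comp_assoc,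
    ← comp_assoc _ _ (halfTwist T), halfTwist_comp_comm, comp_assoc, hT.halfTwist_comp_comul hTT]

/-- Let `(A, R)` be cotriangular with Drinfeld element `u`, and let
`c ∈ A*` be a central grouplike element with `c ∗ c = ε`.  Then `R ∗ R_c` is again a
cotriangular structure on `A`, whose Drinfeld element is `u ∗ c`. -/
theorem statement6 {k A : Type u} [Field k] [IsAlgClosed k] [CharZero k]
    [Ring A] [HopfAlgebra k A]
    (R : A ⊗[k] A →ₗ[k] k) (hR : IsCT (mul' k A) R)
    (c : A →ₗ[k] k) (hgl : IsGrouplikeForm c) (hcen : IsConvCentral c)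
    (hc2 : conv1 c c = Coalgebra.counit) :
    IsCT (mul' k A) (conv2 R (Rc c)) ∧
      drinfeld (conv2 R (Rc c)) = conv1 (drinfeld R) c := by
  have hTT : formTranslate c ∘ₗ formTranslate c = LinearMap.id := by
    rw [formTranslate_comp_formTranslate, hc2, formTranslate_counit]
  have hT := isBicentral_formTranslate hcen
  rw [conv2_Rc, ← comp_formTranslate]
  exact ⟨hR.comp_halfTwist hT hTT (formTranslate_one hgl.1) (formTranslate_mul hgl.2),
    drinfeld_comp_halfTwist R hT hTT (antipode_comp_formTranslate hgl hcen hc2)⟩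

end

end
end

section
/- Let k be an algebraically closed field of characteristic 0 and let A, B be finite-dimensional associative unital k-algebras. Suppose F is a k-linear equivalence between the category of finite-dimensional left A-modules and the category of finite-dimensional left B-modules such that dim_k F(M) = dim_k M for every finite-dimensional left A-module M. Then A and B are isomorphic as k-algebras. -/
open CategoryTheory

noncomputable section

/-- The category of finitely generated (equivalently, finite-dimensional over `k`) modules
over a finite-dimensional `k`-algebra `A` is `k`-linear. -/
instance fgModuleCatLinearOverField (k : Type) [Field k] (A : Type) [Ring A] [Algebra k A] :
    Linear k (FGModuleCat A) := by
  dsimp [FGModuleCat]; infer_instance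

section Modules

universe v

variable {k B : Type} [Field k] [Ring B] [Algebra k B]

theorem finite_quotient_of_isScalarTower {M : Type v} [AddCommGroup M] [Module B M] [Module k M]
    [IsScalarTower k B M] [Module.Finite k M] (m : Submodule B M) : Module.Finite k (M ⧸ m) :=
  Module.Finite.of_surjective (m.mkQ.restrictScalars k) m.mkQ_surjective

/-- The `k`-space of `B`-linear maps between finite-dimensional modules is finite-dimensional. -/
theorem finite_linearMap_of_isScalarTower (M N : Type v) [AddCommGroup M] [Module B M] [Module k M]
    [IsScalarTower k B M] [AddCommGroup N] [Module B N] [Module k N] [IsScalarTower k B N]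
    [Module.Finite k M] [Module.Finite k N] : Module.Finite k (M →ₗ[B] N) :=
  Module.Finite.of_injective (LinearMap.restrictScalarsₗ k B M N k)
    (LinearMap.restrictScalars_injective k)

theorem finrank_linearMap_prod (M₁ M₂ N : Type v) [AddCommGroup M₁] [Module B M₁] [Module k M₁]
    [IsScalarTower k B M₁] [AddCommGroup M₂] [Module B M₂] [Module k M₂] [IsScalarTower k B M₂]
    [AddCommGroup N] [Module B N] [Module k N] [IsScalarTower k B N]
    [Module.Finite k M₁] [Module.Finite k M₂] [Module.Finite k N] :
    Module.finrank k (M₁ × M₂ →ₗ[B] N) =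
      Module.finrank k (M₁ →ₗ[B] N) + Module.finrank k (M₂ →ₗ[B] N) := by
  have := finite_linearMap_of_isScalarTower (k := k) (B := B) M₁ N
  have := finite_linearMap_of_isScalarTower (k := k) (B := B) M₂ N
  rw [← (LinearMap.coprodEquiv k).finrank_eq, Module.finrank_prod]

theorem finrank_linearMap_congr {M M' : Type v} (N : Type v) [AddCommGroup M] [Module B M]
    [AddCommGroup M'] [Module B M'] [AddCommGroup N] [Module B N] [Module k N]
    [IsScalarTower k B N] (e : M ≃ₗ[B] M') :
    Module.finrank k (M →ₗ[B] N) = Module.finrank k (M' →ₗ[B] N) :=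
  LinearEquiv.finrank_eq
    { toFun := fun f => f ∘ₗ e.symm.toLinearMap
      invFun := fun f => f ∘ₗ e.toLinearMap
      map_add' := fun _ _ => rfl
      map_smul' := fun _ _ => rfl
      left_inv := fun f => by ext; simp
      right_inv := fun f => by ext; simp }

/-- A surjection from a semisimple module splits. -/
theorem nonempty_linearEquiv_prod_ker {M S : Type v} [AddCommGroup M] [Module B M]
    [IsSemisimpleModule B M] [AddCommGroup S] [Module B S] (f : M →ₗ[B] S)
    (hf : Function.Surjective f) : Nonempty (M ≃ₗ[B] S × LinearMap.ker f) := by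
  obtain ⟨c, hc⟩ := exists_isCompl (LinearMap.ker f)
  exact ⟨(Submodule.prodEquivOfIsCompl _ _ hc.symm).symm.trans
    (((Submodule.quotientEquivOfIsCompl _ _ hc).symm.trans
      (f.quotKerEquivOfSurjective hf)).prodCongr (LinearEquiv.refl B _))⟩

/-- The `B`-modules `M` and `M'` have `Hom` spaces of equal dimensions into every simple module. -/
def SameSimpleHomDim (k B : Type) (M M' : Type v) [Field k] [Ring B] [Algebra k B] [AddCommGroup M]
    [Module B M] [AddCommGroup M'] [Module B M'] : Prop :=
  ∀ (S : Type v) [AddCommGroup S] [Module B S] [Module k S] [IsScalarTower k B S]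
    [Module.Finite k S] [IsSimpleModule B S],
    Module.finrank k (M →ₗ[B] S) = Module.finrank k (M' →ₗ[B] S)

theorem SameSimpleHomDim.symm {M M' : Type v} [AddCommGroup M] [Module B M] [AddCommGroup M']
    [Module B M'] (h : SameSimpleHomDim k B M M') : SameSimpleHomDim k B M' M := by
  intro S _ _ _ _ _ _
  exact (h S).symm

theorem SameSimpleHomDim.exists_simple_quotient {M M' : Type v} [AddCommGroup M] [Module B M]
    [Module k M] [IsScalarTower k B M] [Module.Finite k M] [AddCommGroup M'] [Module B M']
    [Nontrivial M] (h : SameSimpleHomDim k B M M') :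
    ∃ m : Submodule B M, IsSimpleModule B (M ⧸ m) ∧
      ∃ g : M' →ₗ[B] M ⧸ m, Function.Surjective g := by
  have : Module.Finite B M := Module.Finite.of_restrictScalars_finite k B M
  obtain ⟨m, hm, -⟩ := (eq_top_or_exists_le_coatom (⊥ : Submodule B M)).resolve_left bot_ne_top
  have hs : IsSimpleModule B (M ⧸ m) := isSimpleModule_iff_isCoatom.mpr hm
  have : Module.Finite k (M ⧸ m) := finite_quotient_of_isScalarTower m
  have := finite_linearMap_of_isScalarTower (k := k) (B := B) M (M ⧸ m)
  have hne : m.mkQ ≠ 0 := fun h0 => hm.1 (by rw [← m.ker_mkQ, h0, LinearMap.ker_zero])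
  have : Nontrivial (M →ₗ[B] M ⧸ m) := ⟨⟨_, _, hne⟩⟩
  have hpos : 0 < Module.finrank k (M' →ₗ[B] M ⧸ m) := by
    rw [← h (M ⧸ m)]
    exact Module.finrank_pos
  have := Module.nontrivial_of_finrank_pos hpos
  obtain ⟨g, hg⟩ := exists_ne (0 : M' →ₗ[B] M ⧸ m)
  exact ⟨m, hs, g, LinearMap.surjective_of_ne_zero hg⟩

/-- Semisimple modules are determined by the dimensions of their maps to simple modules. -/
theorem SameSimpleHomDim.nonempty_linearEquiv {M M' : Type v} [AddCommGroup M] [Module B M]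
    [Module k M] [IsScalarTower k B M] [Module.Finite k M] [AddCommGroup M'] [Module B M']
    [Module k M'] [IsScalarTower k B M'] [Module.Finite k M']
    [IsSemisimpleModule B M] [IsSemisimpleModule B M'] (h : SameSimpleHomDim k B M M') :
    Nonempty (M ≃ₗ[B] M') := by
  induction hn : Module.finrank k M using Nat.strong_induction_on generalizing M M' with
  | _ n ih =>
  cases subsingleton_or_nontrivial M with
  | inl hM =>
    cases subsingleton_or_nontrivial M' with
    | inl hM' => exact ⟨LinearEquiv.ofSubsingleton M M'⟩
    | inr hM' =>
      obtain ⟨m, hs, g, hg⟩ := h.symm.exists_simple_quotient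
      have := hs.nontrivial
      exact (not_subsingleton (M' ⧸ m) hg.subsingleton).elim
  | inr hM =>
    obtain ⟨m, hs, g, hg⟩ := h.exists_simple_quotient
    have := finite_quotient_of_isScalarTower (k := k) m
    have hfin {N : Type v} [AddCommGroup N] [Module B N] [Module k N] [IsScalarTower k B N]
        [Module.Finite k N] (K : Submodule B N) : Module.Finite k K :=
      Module.Finite.of_injective (K.subtype.restrictScalars k) K.injective_subtype
    have := hfin (LinearMap.ker m.mkQ)
    have := hfin (LinearMap.ker g)
    obtain ⟨e⟩ := nonempty_linearEquiv_prod_ker m.mkQ m.mkQ_surjective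
    obtain ⟨e'⟩ := nonempty_linearEquiv_prod_ker g hg
    have hlt : Module.finrank k (LinearMap.ker m.mkQ) < n := by
      have h1 := (e.restrictScalars k).finrank_eq
      rw [Module.finrank_prod, hn] at h1
      have := hs.nontrivial
      have h2 : 0 < Module.finrank k (M ⧸ m) := Module.finrank_pos
      omega
    have hker : SameSimpleHomDim k B (LinearMap.ker m.mkQ) (LinearMap.ker g) := by
      intro S _ _ _ _ _ _
      have h1 := h S
      rw [finrank_linearMap_congr S e, finrank_linearMap_congr S e', finrank_linearMap_prod,
        finrank_linearMap_prod] at h1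
      exact Nat.add_left_cancel h1
    obtain ⟨e₀⟩ := ih _ hlt hker rfl
    exact ⟨e.trans (((LinearEquiv.refl B _).prodCongr e₀).trans e'.symm)⟩

/-- The head of a finite-dimensional module is semisimple. -/
theorem isSemisimpleModule_quotient_jacobson (k : Type) {B : Type} [Field k] [Ring B] [Algebra k B]
    [Module.Finite k B] (M : Type v) [AddCommGroup M] [Module B M] [Module.Finite B M] :
    IsSemisimpleModule B (M ⧸ Module.jacobson B M) := by
  have : IsArtinianRing B := IsArtinianRing.of_finite k B
  exact (IsArtinian.isSemisimpleModule_iff_jacobson B _).mpr (Module.jacobson_quotient_jacobson B M)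

theorem finrank_linearMap_quotient_jacobson (M S : Type v) [AddCommGroup M] [Module B M]
    [AddCommGroup S] [Module B S] [Module k S] [IsScalarTower k B S] [IsSimpleModule B S] :
    Module.finrank k (M ⧸ Module.jacobson B M →ₗ[B] S) = Module.finrank k (M →ₗ[B] S) :=
  LinearEquiv.finrank_eq
    { toFun := fun f => f ∘ₗ (Module.jacobson B M).mkQ
      invFun := fun f => (Module.jacobson B M).liftQ f (by
        have h := Module.le_comap_jacobson f
        rwa [IsSemisimpleModule.jacobson_eq_bot B S, Submodule.comap_bot] at h)
      map_add' := fun _ _ => rfl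
      map_smul' := fun _ _ => rfl
      left_inv := fun f => by ext; simp
      right_inv := fun f => by ext; simp }

/-- A map that is surjective onto the head is surjective. -/
theorem surjective_of_surjective_mkQ_jacobson {M N : Type v} [AddCommGroup M] [Module B M]
    [AddCommGroup N] [Module B N] [Module.Finite B N] (f : M →ₗ[B] N)
    (hf : Function.Surjective ((Module.jacobson B N).mkQ ∘ₗ f)) : Function.Surjective f := by
  rw [← LinearMap.range_eq_top]
  refine (eq_top_or_exists_le_coatom (LinearMap.range f)).resolve_right ?_
  rintro ⟨m, hm, hle⟩
  have hJ : Module.jacobson B N ≤ m := sInf_le hm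
  refine hm.1 (eq_top_iff.mpr fun x _ => ?_)
  obtain ⟨y, hy⟩ := hf ((Module.jacobson B N).mkQ x)
  have h1 : f y - x ∈ Module.jacobson B N := (Submodule.Quotient.eq _).mp hy
  have h2 : f y ∈ m := hle ⟨y, rfl⟩
  simpa using m.sub_mem h2 (hJ h1)

/-- Lifting of maps from `P` along surjections of finitely generated `B`-modules. -/
def LiftsFinite (B : Type) (P : Type v) [Ring B] [AddCommGroup P] [Module B P] : Prop :=
  ∀ (N N' : Type v) [AddCommGroup N] [Module B N] [AddCommGroup N'] [Module B N']
    [Module.Finite B N] [Module.Finite B N'] (f : N →ₗ[B] N') (g : P →ₗ[B] N'),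
    Function.Surjective f → ∃ h : P →ₗ[B] N, f ∘ₗ h = g

theorem LiftsFinite.of_projective (B : Type) (P : Type v) [Ring B] [AddCommGroup P] [Module B P]
    [Module.Projective B P] : LiftsFinite B P := by
  intro N N' _ _ _ _ _ _ f g hf
  exact Module.projective_lifting_property f g hf

theorem LiftsFinite.exists_surjective {P Q : Type v} [AddCommGroup P] [Module B P]
    [AddCommGroup Q] [Module B Q] [Module.Finite B Q] (hP : LiftsFinite B P)
    (e : (P ⧸ Module.jacobson B P) ≃ₗ[B] Q ⧸ Module.jacobson B Q) :
    ∃ f : P →ₗ[B] Q, Function.Surjective f := by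
  obtain ⟨f, hf⟩ := hP Q _ (Module.jacobson B Q).mkQ
    (e.toLinearMap ∘ₗ (Module.jacobson B P).mkQ) (Submodule.mkQ_surjective _)
  refine ⟨f, surjective_of_surjective_mkQ_jacobson f ?_⟩
  rw [hf]
  exact e.surjective.comp (Submodule.mkQ_surjective _)

/-- Finite-dimensional projective modules are determined by the dimensions of their maps to
simple modules. -/
theorem LiftsFinite.nonempty_linearEquiv [Module.Finite k B] {P Q : Type v} [AddCommGroup P]
    [Module B P] [Module k P] [IsScalarTower k B P] [Module.Finite k P] [AddCommGroup Q]
    [Module B Q] [Module k Q] [IsScalarTower k B Q] [Module.Finite k Q]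
    (hP : LiftsFinite B P) (hQ : LiftsFinite B Q) (h : SameSimpleHomDim k B P Q) :
    Nonempty (P ≃ₗ[B] Q) := by
  have : Module.Finite B P := Module.Finite.of_restrictScalars_finite k B P
  have : Module.Finite B Q := Module.Finite.of_restrictScalars_finite k B Q
  have := isSemisimpleModule_quotient_jacobson k (B := B) P
  have := isSemisimpleModule_quotient_jacobson k (B := B) Q
  have : Module.Finite k (P ⧸ Module.jacobson B P) :=
    finite_quotient_of_isScalarTower _
  have : Module.Finite k (Q ⧸ Module.jacobson B Q) :=
    finite_quotient_of_isScalarTower _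
  have hJ : SameSimpleHomDim k B (P ⧸ Module.jacobson B P) (Q ⧸ Module.jacobson B Q) := by
    intro S _ _ _ _ _ _
    rw [finrank_linearMap_quotient_jacobson, finrank_linearMap_quotient_jacobson, h S]
  obtain ⟨e⟩ := hJ.nonempty_linearEquiv
  obtain ⟨f, hf⟩ := hP.exists_surjective e
  obtain ⟨g, hg⟩ := hQ.exists_surjective e.symm
  have h1 : Module.finrank k P ≤ Module.finrank k Q :=
    LinearMap.finrank_le_finrank_of_surjective (f := g.restrictScalars k) hg
  have h2 : Module.finrank k Q ≤ Module.finrank k P :=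
    LinearMap.finrank_le_finrank_of_surjective (f := f.restrictScalars k) hf
  have hinj : Function.Injective (f.restrictScalars k) :=
    (LinearMap.injective_iff_surjective_of_finrank_eq_finrank (le_antisymm h1 h2)).mpr hf
  exact ⟨LinearEquiv.ofBijective f ⟨hinj, hf⟩⟩

end Modules

section Category

universe v w

theorem FGModuleCat.surjective_of_epi {A : Type} [Ring A] {X Y : FGModuleCat.{v} A} (f : X ⟶ Y)
    [Epi f] : Function.Surjective f.hom.hom := by
  rw [← LinearMap.range_eq_top, ← Submodule.ker_mkQ (LinearMap.range f.hom.hom),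
    LinearMap.ker_eq_top]
  let p : Y ⟶ FGModuleCat.of A (Y ⧸ LinearMap.range f.hom.hom) :=
    FGModuleCat.ofHom (LinearMap.range f.hom.hom).mkQ
  let z : Y ⟶ FGModuleCat.of A (Y ⧸ LinearMap.range f.hom.hom) := FGModuleCat.ofHom 0
  have h : f ≫ p = f ≫ z := by
    ext x
    exact (Submodule.Quotient.mk_eq_zero _).mpr ⟨x, rfl⟩
  exact congrArg (fun g => g.hom.hom) ((cancel_epi f).mp h)

theorem FGModuleCat.epi_of_surjective {A : Type} [Ring A] {X Y : FGModuleCat.{v} A} (f : X ⟶ Y)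
    (hf : Function.Surjective f.hom.hom) : Epi f where
  left_cancellation g h hgh := by
    ext y
    obtain ⟨x, rfl⟩ := hf y
    exact congrArg (fun t => t.hom.hom x) hgh

theorem FGModuleCat.projective_of_projective (A : Type) [Ring A] (P : Type v) [AddCommGroup P]
    [Module A P] [Module.Finite A P] [Module.Projective A P] :
    Projective (FGModuleCat.of A P) where
  factors f e _ := by
    obtain ⟨h, hh⟩ := Module.projective_lifting_property e.hom.hom f.hom.hom
      (FGModuleCat.surjective_of_epi e)
    exact ⟨FGModuleCat.ofHom h, FGModuleCat.hom_ext hh⟩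

theorem FGModuleCat.liftsFinite_of_projective {B : Type} [Ring B] (P : FGModuleCat.{v} B)
    [Projective P] : LiftsFinite B P := by
  intro N N' _ _ _ _ _ _ f g hf
  have : Epi (FGModuleCat.ofHom f) := FGModuleCat.epi_of_surjective _ hf
  let g' : P ⟶ FGModuleCat.of B N' := FGModuleCat.ofHom g
  exact ⟨(Projective.factorThru g' (FGModuleCat.ofHom f)).hom.hom,
    congrArg (fun t => t.hom.hom) (Projective.factorThru_comp g' (FGModuleCat.ofHom f))⟩

variable {k : Type} [Field k]

/-- Morphisms of `FGModuleCat B` are `k`-linearly the same as `B`-linear maps. -/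
def FGModuleCat.homEquivOfTower {B : Type} [Ring B] [Algebra k B] (P : FGModuleCat.{v} B) (N : Type v)
    [AddCommGroup N] [Module B N] [Module k N] [IsScalarTower k B N] [Module.Finite B N] :
    (P ⟶ FGModuleCat.of B N) ≃ₗ[k] (P →ₗ[B] N) where
  toFun f := f.hom.hom
  invFun f := FGModuleCat.ofHom f
  map_add' _ _ := rfl
  map_smul' r f := by
    ext x
    exact algebraMap_smul B r (f.hom.hom x)
  left_inv _ := rfl
  right_inv _ := rfl

variable {A B : Type} [Ring A] [Ring B] [Algebra k A] [Algebra k B]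

/-- Evaluation at `1`, as a `k`-linear equivalence. -/
def evalOneEquiv (N : Type v) [AddCommGroup N] [Module A N] [Module k N] [IsScalarTower k A N] :
    (ULift.{v} A →ₗ[A] N) ≃ₗ[k] N where
  toFun f := f ⟨1⟩
  invFun n := (LinearMap.toSpanSingleton A N n) ∘ₗ ULift.moduleEquiv.toLinearMap
  map_add' _ _ := rfl
  map_smul' _ _ := rfl
  left_inv f := by
    ext x
    change x.down • f ⟨1⟩ = f x
    rw [← map_smul]
    congr 1
    ext
    simp
  right_inv n := by simp

/-- The `k`-linear equivalence on morphisms induced by a fully faithful `k`-linear functor. -/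
def mapLinearEquiv (F : FGModuleCat.{v} A ⥤ FGModuleCat.{w} B) [F.Full] [F.Faithful] [F.Additive]
    [F.Linear k] (X Y : FGModuleCat.{v} A) : (X ⟶ Y) ≃ₗ[k] (F.obj X ⟶ F.obj Y) :=
  LinearEquiv.ofBijective (F.mapLinearMap k) ⟨F.map_injective, F.map_surjective⟩

/-- A dimension-preserving equivalence carries `A` to a module with the `Hom` dimensions of `B`. -/
theorem finrank_linearMap_obj_self
    (F : FGModuleCat.{v} A ⥤ FGModuleCat.{w} B) [F.IsEquivalence] [F.Additive] [F.Linear k]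
    (hdim : ∀ M : FGModuleCat.{v} A,
      Module.finrank k (RestrictScalars k B (F.obj M)) =
        Module.finrank k (RestrictScalars k A M)) (N : Type w) [AddCommGroup N] [Module B N]
    [Module k N] [IsScalarTower k B N] [Module.Finite B N] :
    Module.finrank k (F.obj (FGModuleCat.of A (ULift.{v} A)) →ₗ[B] N) = Module.finrank k N := by
  let Y := F.objPreimage (FGModuleCat.of B N)
  let i : F.obj Y ≅ FGModuleCat.of B N := F.objObjPreimageIso _
  let _ : Module k Y := Module.restrictScalars k A Y
  have _ : IsScalarTower k A Y := IsScalarTower.restrictScalars k A Y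
  let _ : Module k (F.obj Y) := Module.restrictScalars k B (F.obj Y)
  have _ : IsScalarTower k B (F.obj Y) := IsScalarTower.restrictScalars k B (F.obj Y)
  have hY : Module.finrank k (F.obj Y) = Module.finrank k Y := hdim Y
  let e : (FGModuleCat.of A (ULift.{v} A) ⟶ Y) ≃ₗ[k] Y :=
    (FGModuleCat.homEquivOfTower (FGModuleCat.of A (ULift.{v} A)) Y).trans (evalOneEquiv Y)
  rw [← (FGModuleCat.homEquivOfTower (k := k) (F.obj _) N).finrank_eq,
    ← ((FGModuleCat.isoToLinearEquiv i).restrictScalars k).finrank_eq, hY, ← e.finrank_eq,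
    (mapLinearEquiv (k := k) F _ _).finrank_eq]
  exact (Linear.homCongr k (Iso.refl _) i.symm).finrank_eq

/-- Elements of `A` are the endomorphisms of the regular module, by right multiplication. -/
def regularEndEquiv (k : Type) [Field k] (A : Type) [Ring A] [Algebra k A] :
    A ≃ₗ[k] (FGModuleCat.of A (ULift.{v} A) ⟶ FGModuleCat.of A (ULift.{v} A)) :=
  (ULift.moduleEquiv (R := k) (M := A)).symm.trans
    ((evalOneEquiv (k := k) (A := A) (ULift.{v} A)).symm.trans
      (FGModuleCat.homEquivOfTower (FGModuleCat.of A (ULift.{v} A)) (ULift.{v} A)).symm)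

theorem regularEndEquiv_one (k : Type) [Field k] (A : Type) [Ring A] [Algebra k A] :
    regularEndEquiv.{v} k A 1 = 𝟙 _ := by
  ext x
  exact mul_one x.down

theorem regularEndEquiv_mul (k : Type) [Field k] (A : Type) [Ring A] [Algebra k A] (a b : A) :
    regularEndEquiv.{v} k A (a * b) = regularEndEquiv k A a ≫ regularEndEquiv k A b := by
  ext x
  exact (mul_assoc x.down a b).symm

/-- An equivalence that sends the regular module to the regular module induces an isomorphism of
algebras. -/
def algEquivOfObjSelfIso (F : FGModuleCat.{v} A ⥤ FGModuleCat.{w} B) [F.Full] [F.Faithful]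
    [F.Additive] [F.Linear k]
    (i : F.obj (FGModuleCat.of A (ULift.{v} A)) ≅ FGModuleCat.of B (ULift.{w} B)) : A ≃ₐ[k] B :=
  let φ := ((regularEndEquiv k A).trans (mapLinearEquiv F _ _)).trans (Linear.homCongr k i i)
  have hφ (a : A) : φ a = i.inv ≫ F.map (regularEndEquiv k A a) ≫ i.hom :=
    (Category.assoc i.inv (F.map (regularEndEquiv k A a)) i.hom)
  AlgEquiv.ofLinearEquiv (φ.trans (regularEndEquiv k B).symm)
    (by
      rw [LinearEquiv.trans_apply, LinearEquiv.symm_apply_eq, hφ, regularEndEquiv_one,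
        regularEndEquiv_one]
      simp)
    (by
      intro a b
      rw [LinearEquiv.trans_apply, LinearEquiv.symm_apply_eq, regularEndEquiv_mul]
      simp [hφ, regularEndEquiv_mul])

end Category

/-- Let `k` be an algebraically closed field of characteristic `0` and `A`, `B`
finite-dimensional associative unital `k`-algebras.  If there is a `k`-linear equivalence `F`
between the categories of finite-dimensional left `A`-modules and left `B`-modules with
`dim_k F(M) = dim_k M` for all `M`, then `A ≅ B` as `k`-algebras. -/
theorem algEquiv_of_dimension_preserving_equivalence
    (k : Type) [Field k] [IsAlgClosed k] [CharZero k]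
    (A B : Type) [Ring A] [Ring B] [Algebra k A] [Algebra k B]
    [FiniteDimensional k A] [FiniteDimensional k B]
    (F : FGModuleCat A ⥤ FGModuleCat B) [F.IsEquivalence] [F.Additive] [F.Linear k]
    (hdim : ∀ M : FGModuleCat A,
      Module.finrank k (RestrictScalars k B (F.obj M)) =
        Module.finrank k (RestrictScalars k A M)) :
    Nonempty (A ≃ₐ[k] B) := by
  let P := F.obj (FGModuleCat.of A (ULift A))
  have : Projective (FGModuleCat.of A (ULift A)) := FGModuleCat.projective_of_projective A (ULift A)
  have : Projective P := F.projective_obj _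
  let _ : Module k P := Module.restrictScalars k B P
  have _ : IsScalarTower k B P := IsScalarTower.restrictScalars k B P
  have : Module.Finite k P := Module.Finite.trans B P
  have h : SameSimpleHomDim k B P (ULift B) := by
    intro S _ _ _ _ _ _
    have : Module.Finite B S := Module.Finite.of_restrictScalars_finite k B S
    exact (finrank_linearMap_obj_self F hdim S).trans (evalOneEquiv S).finrank_eq.symm
  obtain ⟨e⟩ := (FGModuleCat.liftsFinite_of_projective P).nonempty_linearEquiv
    (LiftsFinite.of_projective B (ULift B)) h
  exact ⟨algEquivOfObjSelfIso F e.toFGModuleCatIso⟩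

end
end
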